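/- arXiv:1206.5209 — 2 statements merged into one kernel-verified Lean document; each statement's English description precedes it below -/
import Mathlib

section
/- Observability form of Theorem 2 (blow-up of the control cost for small time): For every T < 1 there exist ε0 > 0 and constants C > 0, k > 0 such that for every ε ∈ (0, ε0) there exists a classical solution φ of the adjoint system (S') with ∫_0^T ∫_{Γ0} |φ(t,x',0)|² dx' dt > 0 and ‖φ(0,·)‖_X ≥ C e^{k/ε} ( ∫_0^T ∫_{Γ0} |φ(t,x',0)|² dx' dt )^{1/2}. (By duality this shows that the null-control cost C(ε) of the advection–diffusion system with control on Γ0 satisfies C(ε) ≥ C e^{k/ε}.) -/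
open Real MeasureTheory intervalIntegral Set

noncomputable section

/-- A classical solution of the adjoint system `(S')` on the strip
`Ω = ℝ^m × (−1,0)` (where `m = n−1`): `φ ∈ C^∞`, square-integrable together
with its boundary traces uniformly in `t`, satisfying
`∂_t φ + ∂_{x_n} φ + ε Δφ = 0` in `(0,T) × Ω`,
`ε(∂_t φ − ∂_{x_n} φ) − φ = 0` on `(0,T) × Γ0` (`x_n = 0`) and
`∂_t φ + ∂_{x_n} φ = 0` on `(0,T) × Γ1` (`x_n = −1`). -/
def IsAdjSolND (m : ℕ) (T ε : ℝ) (φ : ℝ → (Fin m → ℝ) → ℝ → ℝ) : Prop :=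
  ContDiff ℝ (⊤ : ℕ∞) (fun p : ℝ × (Fin m → ℝ) × ℝ => φ p.1 p.2.1 p.2.2) ∧
  (∀ t ∈ Set.Icc (0:ℝ) T,
    Integrable (fun p : (Fin m → ℝ) × ℝ => φ t p.1 p.2 ^ 2)
      (volume.restrict ((Set.univ : Set (Fin m → ℝ)) ×ˢ Set.Ioo (-1:ℝ) 0)) ∧
    Integrable (fun x' : Fin m → ℝ => φ t x' 0 ^ 2) ∧
    Integrable (fun x' : Fin m → ℝ => φ t x' (-1) ^ 2)) ∧
  (∀ t ∈ Set.Ioo (0:ℝ) T, ∀ x' : Fin m → ℝ, ∀ xn ∈ Set.Ioo (-1:ℝ) 0,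
    deriv (fun s => φ s x' xn) t + deriv (fun y => φ t x' y) xn
      + ε * ((∑ i : Fin m,
            deriv (deriv (fun h => φ t (Function.update x' i h) xn)) (x' i))
          + deriv (deriv (fun y => φ t x' y)) xn) = 0) ∧
  (∀ t ∈ Set.Ioo (0:ℝ) T, ∀ x' : Fin m → ℝ,
    ε * (deriv (fun s => φ s x' 0) t - deriv (fun y => φ t x' y) 0)
      - φ t x' 0 = 0) ∧
  (∀ t ∈ Set.Ioo (0:ℝ) T, ∀ x' : Fin m → ℝ,
    deriv (fun s => φ s x' (-1)) t + deriv (fun y => φ t x' y) (-1) = 0)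

/-- The squared `X`-norm on the strip `Ω = ℝ^m × (−1,0)`:
`‖ψ‖²_X = ∫_Ω |ψ|² + ε ∫_{∂Ω} |ψ|²`. -/
def XnormSq (m : ℕ) (ε : ℝ) (ψ : (Fin m → ℝ) → ℝ → ℝ) : ℝ :=
  (∫ p : (Fin m → ℝ) × ℝ in
      (Set.univ : Set (Fin m → ℝ)) ×ˢ Set.Ioo (-1:ℝ) 0, ψ p.1 p.2 ^ 2)
    + ε * ((∫ x' : Fin m → ℝ, ψ x' 0 ^ 2) + ∫ x' : Fin m → ℝ, ψ x' (-1) ^ 2)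

open scoped ContDiff Topology Convolution FourierTransform

theorem exists_smooth_dispersion_branch {ε : ℝ} (hε : 0 < ε) :
    ∃ W : ℝ → ℝ, ContDiff ℝ ∞ W ∧ ∃ δ > 0, ∀ s, |s| < δ → W s ∈ Ioo 0 π ∧
      (ε * (W s ^ 2 + s) - 1 / (4 * ε)) * cos (W s / 2) = -(W s * sin (W s / 2)) := by
  obtain ⟨w₀, hw₀, hroot⟩ : ∃ w ∈ Ioo 0 π,
      (1 / (4 * ε) - ε * w ^ 2) * cos (w / 2) - w * sin (w / 2) = 0 := by
    refine intermediate_value_Ioo' pi_pos.le (f := fun w : ℝ =>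
      (1 / (4 * ε) - ε * w ^ 2) * cos (w / 2) - w * sin (w / 2)) (by fun_prop) ⟨?_, ?_⟩
    · simpa using pi_pos
    · simpa using hε
  have hcos : ∀ w ∈ Ioo 0 π, 0 < cos (w / 2) := fun w hw =>
    cos_pos_of_mem_Ioo ⟨by linarith [hw.1, pi_pos], by linarith [hw.2]⟩
  have hc₀ := hcos w₀ hw₀
  have hs₀ : 0 < sin (w₀ / 2) := sin_pos_of_pos_of_lt_pi (by linarith [hw₀.1])
    (by linarith [hw₀.1, hw₀.2])
  let f : ℝ → ℝ := fun w => (1 / (4 * ε) - w * (sin (w / 2) / cos (w / 2))) / ε - w ^ 2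
  have hf₀ : f w₀ = 0 := by
    simp only [f]
    field_simp
    field_simp at hroot
    linarith
  have hfd : ContDiffAt ℝ ω f w₀ := by
    have : ContDiffAt ℝ ω (fun w : ℝ => sin (w / 2) / cos (w / 2)) w₀ :=
      ContDiffAt.div (by fun_prop) (by fun_prop) hc₀.ne'
    simp only [f]
    fun_prop
  obtain ⟨d, hd, hfderiv⟩ : ∃ d : ℝ, d ≠ 0 ∧ HasDerivAt f d w₀ := by
    have h1 : HasDerivAt (fun w : ℝ => w / 2) (1 / 2) w₀ := (hasDerivAt_id w₀).div_const 2
    have h2 := (hasDerivAt_id w₀).mul (h1.sin.div h1.cos hc₀.ne')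
    have h3 := ((h2.const_sub (1 / (4 * ε))).div_const ε).sub (hasDerivAt_pow 2 w₀)
    refine ⟨_, ?_, h3⟩
    have hw := hw₀.1
    apply ne_of_lt
    have e : cos (w₀ / 2) * (1 / 2) * cos (w₀ / 2) - sin (w₀ / 2) * (-sin (w₀ / 2) * (1 / 2))
        = 1 / 2 := by nlinarith [sin_sq_add_cos_sq (w₀ / 2)]
    simp only [e, id, one_mul, neg_div]
    have : 0 < (sin (w₀ / 2) / cos (w₀ / 2) + w₀ * (1 / 2 / cos (w₀ / 2) ^ 2)) / ε := by
      positivity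
    norm_num
    norm_num at this
    linarith
  have hfe := hfderiv.hasFDerivAt_equiv hd
  have hω : (ω : WithTop ℕ∞) ≠ 0 := by simp
  set W := hfd.localInverse hfe hω
  have hWan : ∀ᶠ s in 𝓝 (0 : ℝ), AnalyticAt ℝ W s := by
    have := hfd.to_localInverse hfe hω
    rw [hf₀] at this
    exact (this.analyticAt).eventually_analyticAt
  have hWinv : ∀ᶠ s in 𝓝 (0 : ℝ), f (W s) = s := by
    have := (hfd.hasStrictFDerivAt' hfe hω).eventually_right_inverse
    rwa [hf₀] at this
  have hW₀ : W 0 = w₀ := by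
    rw [← hf₀]; exact hfd.localInverse_apply_image hfe hω
  have hWmem : ∀ᶠ s in 𝓝 (0 : ℝ), W s ∈ Ioo 0 π :=
    hWan.self_of_nhds.continuousAt.eventually_mem
      (by rw [hW₀]; exact isOpen_Ioo.mem_nhds hw₀)
  obtain ⟨r, hr, hball⟩ := Metric.eventually_nhds_iff_ball.1 (hWan.and (hWinv.and hWmem))
  let χ : ContDiffBump (0 : ℝ) := ⟨r / 4, r / 2, by positivity, by linarith⟩
  refine ⟨fun s => χ s * W s, ?_, r / 4, by positivity, fun s hs => ?_⟩
  · refine contDiff_iff_contDiffAt.2 fun s => ?_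
    by_cases hs : s ∈ Metric.ball (0 : ℝ) r
    · exact χ.contDiff.contDiffAt.mul (hball s hs).1.contDiffAt
    · have : s ∉ tsupport χ := by
        rw [χ.tsupport_eq]
        intro h
        refine hs (Metric.closedBall_subset_ball ?_ h)
        change r / 2 < r
        linarith
      refine contDiffAt_const (c := (0 : ℝ)).congr_of_eventuallyEq ?_
      filter_upwards [notMem_tsupport_iff_eventuallyEq.1 this] with x hx
      simp [hx]
  · have h1 : χ s = 1 := χ.one_of_mem_closedBall (by simpa [χ] using hs.le)
    obtain ⟨-, h2, h3⟩ := hball s (by simp; linarith)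
    simp only [h1, one_mul]
    refine ⟨h3, ?_⟩
    have hc := hcos _ h3
    generalize W s = w at *
    simp only [f] at h2
    rw [← h2]
    field_simp
    ring

theorem contDiff_integral_of_compact_support {G P : Type*} [NormedAddCommGroup G]
    [NormedSpace ℝ G] [MeasurableSpace G] [BorelSpace G] [NormedAddCommGroup P] [NormedSpace ℝ P]
    {μ : Measure G} [IsLocallyFiniteMeasure μ] {K : P → G → ℝ} {k : Set G} (hk : IsCompact k)
    (hK : ∀ p ξ, ξ ∉ k → K p ξ = 0) (hc : ContDiff ℝ ∞ (fun q : P × G => K q.1 q.2)) :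
    ContDiff ℝ ∞ (fun p => ∫ ξ, K p ξ ∂μ) := by
  have hneg : ContDiff ℝ ∞ (fun q : P × G => K q.1 (-q.2)) :=
    hc.comp (contDiff_fst.prodMk contDiff_snd.neg)
  have := contDiffOn_convolution_right_with_param_comp (μ := μ) (n := ⊤)
    (ContinuousLinearMap.mul ℝ ℝ) (s := (univ : Set P)) (v := fun _ => (0 : G)) contDiffOn_const
    (f := fun _ : G => (1 : ℝ)) (g := fun p ξ => K p (-ξ)) (k := -k) isOpen_univ hk.neg
    (fun p ξ _ hξ => hK p _ (by simpa using hξ)) (locallyIntegrable_const 1) hneg.contDiffOn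
  rw [contDiffOn_univ] at this
  simpa [convolution] using this

theorem hasDerivAt_integral_of_compact_support {G : Type*} [NormedAddCommGroup G]
    [MeasurableSpace G] [BorelSpace G] {μ : Measure G} [IsFiniteMeasureOnCompacts μ]
    {F F' : ℝ → G → ℝ} {k : Set G} (hk : IsCompact k)
    (hF0 : ∀ h ξ, ξ ∉ k → F h ξ = 0) (hF'0 : ∀ h ξ, ξ ∉ k → F' h ξ = 0)
    (hF : Continuous (fun q : ℝ × G => F q.1 q.2)) (hF' : Continuous (fun q : ℝ × G => F' q.1 q.2))
    (hd : ∀ h ξ, HasDerivAt (fun s => F s ξ) (F' h ξ) h) (x : ℝ) :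
    HasDerivAt (fun h => ∫ ξ, F h ξ ∂μ) (∫ ξ, F' x ξ ∂μ) x := by
  have hint : ∀ {H : ℝ → G → ℝ}, (∀ h ξ, ξ ∉ k → H h ξ = 0) →
      Continuous (fun q : ℝ × G => H q.1 q.2) → ∀ h, Integrable (H h) μ := fun {H} h0 hc h =>
    Continuous.integrable_of_hasCompactSupport (hc.comp (by fun_prop : Continuous (fun ξ => (h, ξ))))
      (HasCompactSupport.intro hk (h0 h))
  obtain ⟨M, hM⟩ := ((isCompact_closedBall x 1).prod hk).exists_bound_of_continuousOn
    hF'.continuousOn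
  refine (hasDerivAt_integral_of_dominated_loc_of_deriv_le (bound := k.indicator fun _ => M)
    (Metric.closedBall_mem_nhds x one_pos) (.of_forall fun h => (hint hF0 hF h).aestronglyMeasurable)
    (hint hF0 hF x) (hint hF'0 hF' x).aestronglyMeasurable (.of_forall fun ξ h hh => ?_) ?_
    (.of_forall fun ξ h _ => hd h ξ)).2
  · by_cases hξ : ξ ∈ k
    · simpa [hξ] using hM (h, ξ) ⟨hh, hξ⟩
    · simp [hξ, hF'0]
  · rw [integrable_indicator_iff hk.isClosed.measurableSet]
    exact integrableOn_const hk.measure_lt_top.ne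

/-- The cosine transform of `a : ℝ^m → ℝ`. -/
def cosTransform (m : ℕ) (a : EuclideanSpace ℝ (Fin m) → ℝ) (y : Fin m → ℝ) : ℝ :=
  ∫ ξ, a ξ * cos (2 * π * ∑ i, ξ i * y i)

theorem norm_fourier_eq_abs_cosTransform {m : ℕ} {a : EuclideanSpace ℝ (Fin m) → ℝ}
    (ha : Integrable a) (heven : ∀ ξ, a (-ξ) = a ξ) (x : EuclideanSpace ℝ (Fin m)) :
    ‖𝓕 (fun ξ => (a ξ : ℂ)) x‖ = |cosTransform m a x| := by
  have hinner : ∀ ξ : EuclideanSpace ℝ (Fin m), inner ℝ ξ x = ∑ i, ξ i * x i := fun ξ => by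
    simp [PiLp.inner_apply, mul_comm]
  have hodd : ∫ ξ, a ξ * sin (2 * π * ∑ i, ξ i * x i) = 0 := by
    have := integral_neg_eq_self (fun ξ : EuclideanSpace ℝ (Fin m) =>
      a ξ * sin (2 * π * ∑ i, ξ i * x i)) volume
    simp only [heven, PiLp.neg_apply, neg_mul, Finset.sum_neg_distrib, mul_neg, sin_neg,
      MeasureTheory.integral_neg] at this
    linarith
  have hcI : Integrable (fun ξ => a ξ * cos (2 * π * ∑ i, ξ i * x i)) := by
    refine ha.mul_bdd (c := 1) (by fun_prop) (.of_forall fun ξ => ?_)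
    exact abs_cos_le_one _
  have hsI : Integrable (fun ξ => a ξ * sin (2 * π * ∑ i, ξ i * x i)) := by
    refine ha.mul_bdd (c := 1) (by fun_prop) (.of_forall fun ξ => ?_)
    exact abs_sin_le_one _
  have key : 𝓕 (fun ξ => (a ξ : ℂ)) x = (cosTransform m a x : ℂ) := by
    rw [Real.fourier_eq']
    have : ∀ ξ : EuclideanSpace ℝ (Fin m),
        Complex.exp (↑(-2 * π * inner ℝ ξ x) * Complex.I) • (a ξ : ℂ) =
          ((a ξ * cos (2 * π * ∑ i, ξ i * x i) : ℝ) : ℂ)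
            - ((a ξ * sin (2 * π * ∑ i, ξ i * x i) : ℝ) : ℂ) * Complex.I := by
      intro ξ
      rw [hinner, Complex.exp_mul_I, ← Complex.ofReal_cos, ← Complex.ofReal_sin, neg_mul, neg_mul,
        cos_neg, sin_neg]
      push_cast
      rw [smul_eq_mul]
      ring
    simp_rw [this]
    rw [integral_sub hcI.ofReal (hsI.ofReal.mul_const _), MeasureTheory.integral_mul_const,
      integral_complex_ofReal, integral_complex_ofReal, hodd]
    simp [cosTransform]
  rw [key, Complex.norm_real, norm_eq_abs]

theorem integral_sq_cosTransform {m : ℕ} {a : EuclideanSpace ℝ (Fin m) → ℝ}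
    (ha : ContDiff ℝ ∞ a) (hc : HasCompactSupport a) (heven : ∀ ξ, a (-ξ) = a ξ) :
    Integrable (fun y => cosTransform m a y ^ 2) ∧
      ∫ y, cosTransform m a y ^ 2 = ∫ ξ, a ξ ^ 2 := by
  have hcC : HasCompactSupport (fun ξ => (a ξ : ℂ)) := hc.comp_left Complex.ofReal_zero
  have haC : ContDiff ℝ ∞ (fun ξ => (a ξ : ℂ)) := Complex.ofRealCLM.contDiff.comp ha
  let f := hcC.toSchwartzMap haC
  have hf : ∀ x, ‖𝓕 f x‖ ^ 2 = cosTransform m a x ^ 2 := fun x => by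
    rw [← sq_abs (cosTransform m a x), ← norm_fourier_eq_abs_cosTransform
      (ha.continuous.integrable_of_hasCompactSupport hc) heven, SchwartzMap.fourier_coe]
    rfl
  have hint : Integrable (fun x => ‖𝓕 f x‖ ^ 2) :=
    ((𝓕 f).memLp 2 volume).integrable_norm_pow (by norm_num)
  have hpl := SchwartzMap.integral_norm_sq_fourier f
  simp_rw [hf] at hint hpl
  have hmp := PiLp.volume_preserving_ofLp (Fin m)
  have hemb : MeasurableEmbedding (@WithLp.ofLp 2 (Fin m → ℝ)) :=
    (MeasurableEquiv.toLp 2 (Fin m → ℝ)).symm.measurableEmbedding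
  refine ⟨(hmp.integrable_comp_emb hemb).1 hint, ?_⟩
  rw [← hmp.integral_comp hemb, hpl]
  simp [f]

section CosTransform

variable {m : ℕ}

theorem integrable_mul_cos {a : EuclideanSpace ℝ (Fin m) → ℝ} (ha : Integrable a)
    (y : Fin m → ℝ) : Integrable (fun ξ => a ξ * cos (2 * π * ∑ i, ξ i * y i)) :=
  ha.mul_bdd (c := 1) (by fun_prop) (.of_forall fun _ => abs_cos_le_one _)

theorem cosTransform_add {a b : EuclideanSpace ℝ (Fin m) → ℝ} (ha : Integrable a)
    (hb : Integrable b) (y : Fin m → ℝ) :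
    cosTransform m (fun ξ => a ξ + b ξ) y = cosTransform m a y + cosTransform m b y := by
  simp only [cosTransform, add_mul]
  exact MeasureTheory.integral_add (integrable_mul_cos ha y) (integrable_mul_cos hb y)

theorem cosTransform_const_mul (c : ℝ) (a : EuclideanSpace ℝ (Fin m) → ℝ) (y : Fin m → ℝ) :
    cosTransform m (fun ξ => c * a ξ) y = c * cosTransform m a y := by
  simp only [cosTransform, mul_assoc, MeasureTheory.integral_const_mul]

theorem cosTransform_sum {a : Fin m → EuclideanSpace ℝ (Fin m) → ℝ} (ha : ∀ i, Integrable (a i))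
    (y : Fin m → ℝ) :
    cosTransform m (fun ξ => ∑ i, a i ξ) y = ∑ i, cosTransform m (a i) y := by
  simp only [cosTransform, Finset.sum_mul]
  exact integral_finsetSum _ fun i _ => integrable_mul_cos (ha i) y

theorem hasDerivAt_cosTransform {A A' : ℝ → EuclideanSpace ℝ (Fin m) → ℝ}
    {k : Set (EuclideanSpace ℝ (Fin m))} (hk : IsCompact k)
    (hA0 : ∀ h ξ, ξ ∉ k → A h ξ = 0) (hA'0 : ∀ h ξ, ξ ∉ k → A' h ξ = 0)
    (hA : Continuous (fun q : ℝ × EuclideanSpace ℝ (Fin m) => A q.1 q.2))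
    (hA' : Continuous (fun q : ℝ × EuclideanSpace ℝ (Fin m) => A' q.1 q.2))
    (hd : ∀ h ξ, HasDerivAt (fun s => A s ξ) (A' h ξ) h) (y : Fin m → ℝ) (h : ℝ) :
    HasDerivAt (fun h => cosTransform m (A h) y) (cosTransform m (A' h) y) h := by
  refine hasDerivAt_integral_of_compact_support
    (F := fun h ξ => A h ξ * cos (2 * π * ∑ i, ξ i * y i))
    (F' := fun h ξ => A' h ξ * cos (2 * π * ∑ i, ξ i * y i)) hk
    (fun h ξ hξ => by simp [hA0 h ξ hξ]) (fun h ξ hξ => by simp [hA'0 h ξ hξ])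
    (hA.mul (by fun_prop)) (hA'.mul (by fun_prop)) (fun h ξ => (hd h ξ).mul_const _) h

theorem deriv_deriv_cosTransform_update {a : EuclideanSpace ℝ (Fin m) → ℝ} (ha : Continuous a)
    (hc : HasCompactSupport a) (y : Fin m → ℝ) (i : Fin m) :
    deriv (deriv (fun h => cosTransform m a (Function.update y i h))) (y i) =
      cosTransform m (fun ξ => -((2 * π * ξ i) ^ 2) * a ξ) y := by
  have ha0 : ∀ ξ, ξ ∉ tsupport a → a ξ = 0 := fun ξ => image_eq_zero_of_notMem_tsupport
  have hphase : ∀ (h : ℝ) (ξ : EuclideanSpace ℝ (Fin m)),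
      HasDerivAt (fun h => 2 * π * ∑ j, ξ j * Function.update y i h j) (2 * π * ξ i) h := by
    intro h ξ
    refine HasDerivAt.const_mul _ ?_
    have := HasDerivAt.fun_sum (u := Finset.univ) fun j _ =>
      ((hasDerivAt_pi.1 (hasDerivAt_update y i h)) j).const_mul (ξ j)
    refine this.congr_deriv ?_
    simp [Pi.single_apply]
  have hcont : Continuous (fun q : ℝ × EuclideanSpace ℝ (Fin m) =>
      2 * π * ∑ j, q.2 j * Function.update y i q.1 j) := by
    refine continuous_const.mul (continuous_finsetSum _ fun j _ => ?_)
    refine Continuous.mul (by fun_prop) ?_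
    by_cases hj : j = i
    · subst hj; simpa using continuous_fst
    · simpa [hj] using continuous_const
  have hcoord : Continuous (fun q : ℝ × EuclideanSpace ℝ (Fin m) => 2 * π * q.2 i) := by fun_prop
  have haq : Continuous (fun q : ℝ × EuclideanSpace ℝ (Fin m) => a q.2) := ha.comp continuous_snd
  have hcos := Real.continuous_cos.comp hcont
  have hsin := Real.continuous_sin.comp hcont
  have h1 : deriv (fun h => cosTransform m a (Function.update y i h)) = fun h =>
      ∫ ξ, a ξ * (-sin (2 * π * ∑ j, ξ j * Function.update y i h j) * (2 * π * ξ i)) := by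
    funext h
    exact (hasDerivAt_integral_of_compact_support
      (F := fun h ξ => a ξ * cos (2 * π * ∑ j, ξ j * Function.update y i h j))
      (F' := fun h ξ => a ξ * (-sin (2 * π * ∑ j, ξ j * Function.update y i h j) * (2 * π * ξ i)))
      hc (fun h ξ hξ => by simp [ha0 ξ hξ]) (fun h ξ hξ => by simp [ha0 ξ hξ])
      (haq.mul hcos) (haq.mul (hsin.neg.mul hcoord))
      (fun h ξ => (hphase h ξ).cos.const_mul _) h).deriv
  rw [h1]
  have h2 := (hasDerivAt_integral_of_compact_support (μ := volume)
      (F := fun h ξ => a ξ * (-sin (2 * π * ∑ j, ξ j * Function.update y i h j) * (2 * π * ξ i)))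
      (F' := fun h ξ => a ξ * (-(cos (2 * π * ∑ j, ξ j * Function.update y i h j) * (2 * π * ξ i))
        * (2 * π * ξ i)))
      hc (fun h ξ hξ => by simp [ha0 ξ hξ]) (fun h ξ hξ => by simp [ha0 ξ hξ])
      (haq.mul (hsin.neg.mul hcoord))
      (haq.mul ((hcos.mul hcoord).neg.mul hcoord))
      (fun h ξ => ((hphase h ξ).sin.fun_neg.mul_const _).const_mul _) (y i)).deriv
  rw [h2]
  simp only [Function.update_eq_self, cosTransform]
  congr 1
  funext ξ
  ring

end CosTransform

section StripMode

variable {m : ℕ} {ε : ℝ} {g w l : EuclideanSpace ℝ (Fin m) → ℝ}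

/-- At each tangential frequency `ξ`, a separated solution of the adjoint system on the strip, with
`q` in place of the cosine profile. -/
def stripAmplitude (ε : ℝ) (g l : EuclideanSpace ℝ (Fin m) → ℝ)
    (q : EuclideanSpace ℝ (Fin m) → ℝ → ℝ) (t x : ℝ) (ξ : EuclideanSpace ℝ (Fin m)) : ℝ :=
  g ξ * (exp (l ξ * t - x / (2 * ε)) * q ξ x)

/-- The superposition of separated solutions with profile `cos (w (x + 1/2))`. -/
def stripMode (ε : ℝ) (g w l : EuclideanSpace ℝ (Fin m) → ℝ) (t : ℝ) (y : Fin m → ℝ) (x : ℝ) : ℝ :=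
  cosTransform m (stripAmplitude ε g l (fun ξ x => cos (w ξ * (x + 1 / 2))) t x) y

theorem contDiff_stripAmplitude (hg : ContDiff ℝ ∞ g) (hw : ContDiff ℝ ∞ w)
    (hl : ContDiff ℝ ∞ l) :
    ContDiff ℝ ∞ (fun p : (ℝ × ℝ) × EuclideanSpace ℝ (Fin m) =>
      stripAmplitude ε g l (fun ξ x => cos (w ξ * (x + 1 / 2))) p.1.1 p.1.2 p.2) := by
  unfold stripAmplitude
  fun_prop

theorem stripAmplitude_eq_zero {q : EuclideanSpace ℝ (Fin m) → ℝ → ℝ} (t x : ℝ)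
    {ξ : EuclideanSpace ℝ (Fin m)} (hξ : ξ ∉ tsupport g) : stripAmplitude ε g l q t x ξ = 0 := by
  simp [stripAmplitude, image_eq_zero_of_notMem_tsupport hξ]

theorem contDiff_stripMode (hg : ContDiff ℝ ∞ g) (hgc : HasCompactSupport g)
    (hw : ContDiff ℝ ∞ w) (hl : ContDiff ℝ ∞ l) :
    ContDiff ℝ ∞ (fun p : ℝ × (Fin m → ℝ) × ℝ => stripMode ε g w l p.1 p.2.1 p.2.2) := by
  refine contDiff_integral_of_compact_support (P := ℝ × (Fin m → ℝ) × ℝ)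
    (K := fun p ξ => stripAmplitude ε g l (fun ξ x => cos (w ξ * (x + 1 / 2))) p.1 p.2.2 ξ *
      cos (2 * π * ∑ i, ξ i * p.2.1 i)) hgc
    (fun p ξ hξ => by rw [stripAmplitude_eq_zero _ _ hξ, zero_mul]) ?_
  refine ContDiff.mul ?_ ?_
  · exact (contDiff_stripAmplitude hg hw hl).comp (g := fun p : (ℝ × ℝ) × EuclideanSpace ℝ (Fin m) =>
      stripAmplitude ε g l (fun ξ x => cos (w ξ * (x + 1 / 2))) p.1.1 p.1.2 p.2)
      (f := fun q : (ℝ × (Fin m → ℝ) × ℝ) × EuclideanSpace ℝ (Fin m) => ((q.1.1, q.1.2.2), q.2))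
      (by fun_prop)
  · fun_prop

theorem continuous_stripAmplitude (hg : Continuous g) (hl : Continuous l)
    {q : EuclideanSpace ℝ (Fin m) → ℝ → ℝ} (hq : Continuous (fun p : EuclideanSpace ℝ (Fin m) × ℝ =>
      q p.1 p.2)) :
    Continuous (fun p : (ℝ × ℝ) × EuclideanSpace ℝ (Fin m) =>
      stripAmplitude ε g l q p.1.1 p.1.2 p.2) := by
  unfold stripAmplitude
  have := hq.comp (by fun_prop :
    Continuous (fun p : (ℝ × ℝ) × EuclideanSpace ℝ (Fin m) => (p.2, p.1.2)))
  simp only [Function.comp_def] at this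
  fun_prop

theorem hasDerivAt_time (hg : Continuous g) (hgc : HasCompactSupport g) (hl : Continuous l)
    {q : EuclideanSpace ℝ (Fin m) → ℝ → ℝ}
    (hq : Continuous (fun p : EuclideanSpace ℝ (Fin m) × ℝ => q p.1 p.2))
    (t : ℝ) (y : Fin m → ℝ) (x : ℝ) :
    HasDerivAt (fun t => cosTransform m (stripAmplitude ε g l q t x) y)
      (cosTransform m (stripAmplitude ε g l (fun ξ x => l ξ * q ξ x) t x) y) t := by
  refine hasDerivAt_cosTransform (A := fun t => stripAmplitude ε g l q t x)
    (A' := fun t => stripAmplitude ε g l (fun ξ x => l ξ * q ξ x) t x) hgc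
    (fun h ξ hξ => stripAmplitude_eq_zero _ _ hξ) (fun h ξ hξ => stripAmplitude_eq_zero _ _ hξ)
    ?_ ?_ (fun h ξ => ?_) y t
  · exact (continuous_stripAmplitude hg hl hq).comp (by fun_prop :
      Continuous fun p : ℝ × EuclideanSpace ℝ (Fin m) => ((p.1, x), p.2))
  · exact (continuous_stripAmplitude (q := fun ξ x => l ξ * q ξ x) hg hl (by fun_prop)).comp
      (by fun_prop : Continuous fun p : ℝ × EuclideanSpace ℝ (Fin m) => ((p.1, x), p.2))
  · have := ((((hasDerivAt_id h).const_mul (l ξ)).sub_const (x / (2 * ε))).exp.mul_const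
      (q ξ x)).const_mul (g ξ)
    refine this.congr_deriv ?_
    simp only [stripAmplitude, id]
    ring

theorem hasDerivAt_normal (hg : Continuous g) (hgc : HasCompactSupport g) (hl : Continuous l)
    {q q' : EuclideanSpace ℝ (Fin m) → ℝ → ℝ}
    (hq : Continuous (fun p : EuclideanSpace ℝ (Fin m) × ℝ => q p.1 p.2))
    (hq' : Continuous (fun p : EuclideanSpace ℝ (Fin m) × ℝ => q' p.1 p.2))
    (hd : ∀ ξ x, HasDerivAt (q ξ) (q' ξ x) x) (t : ℝ) (y : Fin m → ℝ) (x : ℝ) :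
    HasDerivAt (fun x => cosTransform m (stripAmplitude ε g l q t x) y)
      (cosTransform m (stripAmplitude ε g l (fun ξ x => q' ξ x - q ξ x / (2 * ε)) t x) y) x := by
  refine hasDerivAt_cosTransform (A := fun x => stripAmplitude ε g l q t x)
    (A' := fun x => stripAmplitude ε g l (fun ξ x => q' ξ x - q ξ x / (2 * ε)) t x) hgc
    (fun h ξ hξ => stripAmplitude_eq_zero _ _ hξ) (fun h ξ hξ => stripAmplitude_eq_zero _ _ hξ)
    ?_ ?_ (fun h ξ => ?_) y x
  · exact (continuous_stripAmplitude hg hl hq).comp (by fun_prop :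
      Continuous fun p : ℝ × EuclideanSpace ℝ (Fin m) => ((t, p.1), p.2))
  · exact (continuous_stripAmplitude (q := fun ξ x => q' ξ x - q ξ x / (2 * ε)) hg hl
      (by fun_prop)).comp
      (by fun_prop : Continuous fun p : ℝ × EuclideanSpace ℝ (Fin m) => ((t, p.1), p.2))
  · have := ((((hasDerivAt_id h).div_const (2 * ε)).const_sub (l ξ * t)).exp.mul
      (hd ξ h)).const_mul (g ξ)
    refine this.congr_deriv ?_
    simp only [stripAmplitude, id]
    ring

theorem integrable_stripAmplitude (hg : Continuous g) (hgc : HasCompactSupport g)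
    (hl : Continuous l) {q : EuclideanSpace ℝ (Fin m) → ℝ → ℝ}
    (hq : Continuous (fun p : EuclideanSpace ℝ (Fin m) × ℝ => q p.1 p.2)) (t x : ℝ) :
    Integrable (stripAmplitude ε g l q t x) :=
  Continuous.integrable_of_hasCompactSupport ((continuous_stripAmplitude hg hl hq).comp
    (by fun_prop : Continuous fun ξ : EuclideanSpace ℝ (Fin m) => ((t, x), ξ)))
    (HasCompactSupport.intro hgc fun _ => stripAmplitude_eq_zero t x)

theorem hasDerivAt_phase (a x : ℝ) : HasDerivAt (fun x => a * (x + 1 / 2)) a x := by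
  simpa only [mul_one] using ((hasDerivAt_id' x).add_const (1 / 2)).const_mul a

theorem hasDerivAt_stripMode_time (hg : Continuous g) (hgc : HasCompactSupport g)
    (hw : Continuous w) (hl : Continuous l) (t : ℝ) (y : Fin m → ℝ) (x : ℝ) :
    HasDerivAt (fun s => stripMode ε g w l s y x)
      (cosTransform m (stripAmplitude ε g l (fun ξ x => l ξ * cos (w ξ * (x + 1 / 2))) t x) y) t :=
  hasDerivAt_time hg hgc hl (q := fun ξ x => cos (w ξ * (x + 1 / 2))) (by fun_prop) t y x

theorem hasDerivAt_stripMode_normal (hg : Continuous g) (hgc : HasCompactSupport g)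
    (hw : Continuous w) (hl : Continuous l) (t : ℝ) (y : Fin m → ℝ) (x : ℝ) :
    HasDerivAt (fun x => stripMode ε g w l t y x)
      (cosTransform m (stripAmplitude ε g l (fun ξ x => -sin (w ξ * (x + 1 / 2)) * w ξ -
        cos (w ξ * (x + 1 / 2)) / (2 * ε)) t x) y) x :=
  hasDerivAt_normal hg hgc hl (q := fun ξ x => cos (w ξ * (x + 1 / 2)))
    (q' := fun ξ x => -sin (w ξ * (x + 1 / 2)) * w ξ) (by fun_prop) (by fun_prop)
    (fun ξ x => (hasDerivAt_phase (w ξ) x).cos) t y x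

theorem stripMode_pde (hε : 0 < ε) (hg : Continuous g) (hgc : HasCompactSupport g)
    (hw : Continuous w) (hl : Continuous l)
    (hlw : ∀ ξ, g ξ ≠ 0 → l ξ = 1 / (4 * ε) + ε * (w ξ ^ 2 + (2 * π * ‖ξ‖) ^ 2))
    (t : ℝ) (y : Fin m → ℝ) (x : ℝ) :
    deriv (fun s => stripMode ε g w l s y x) t + deriv (fun x => stripMode ε g w l t y x) x
      + ε * ((∑ i : Fin m,
            deriv (deriv (fun h => stripMode ε g w l t (Function.update y i h) x)) (y i))
          + deriv (deriv (fun x => stripMode ε g w l t y x)) x) = 0 := by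
  let q : EuclideanSpace ℝ (Fin m) → ℝ → ℝ := fun ξ x => cos (w ξ * (x + 1 / 2))
  let q' : EuclideanSpace ℝ (Fin m) → ℝ → ℝ := fun ξ x => -sin (w ξ * (x + 1 / 2)) * w ξ
  let q'' : EuclideanSpace ℝ (Fin m) → ℝ → ℝ := fun ξ x =>
    -(cos (w ξ * (x + 1 / 2)) * w ξ) * w ξ
  have hq : Continuous (fun p : EuclideanSpace ℝ (Fin m) × ℝ => q p.1 p.2) := by
    simp only [q]; fun_prop
  have hq' : Continuous (fun p : EuclideanSpace ℝ (Fin m) × ℝ => q' p.1 p.2) := by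
    simp only [q']; fun_prop
  have hq'' : Continuous (fun p : EuclideanSpace ℝ (Fin m) × ℝ => q'' p.1 p.2) := by
    simp only [q'']; fun_prop
  have hd : ∀ ξ x, HasDerivAt (q ξ) (q' ξ x) x := fun ξ x => (hasDerivAt_phase (w ξ) x).cos
  have hd' : ∀ ξ x, HasDerivAt (q' ξ) (q'' ξ x) x := fun ξ x =>
    (hasDerivAt_phase (w ξ) x).sin.neg.mul_const _
  have hx : deriv (fun x => stripMode ε g w l t y x) = fun x =>
      cosTransform m (stripAmplitude ε g l (fun ξ x => q' ξ x - q ξ x / (2 * ε)) t x) y :=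
    funext fun x => (hasDerivAt_stripMode_normal hg hgc hw hl t y x).deriv
  have hxx := (hasDerivAt_normal (ε := ε) hg hgc hl
    (q := fun ξ x => q' ξ x - q ξ x / (2 * ε))
    (q' := fun ξ x => q'' ξ x - q' ξ x / (2 * ε))
    (by fun_prop) (by fun_prop) (fun ξ x => (hd' ξ x).sub ((hd ξ x).div_const _)) t y x).deriv
  have hA : Continuous (stripAmplitude ε g l q t x) :=
    (continuous_stripAmplitude hg hl hq).comp
      (by fun_prop : Continuous fun ξ : EuclideanSpace ℝ (Fin m) => ((t, x), ξ))
  have hAc : HasCompactSupport (stripAmplitude ε g l q t x) :=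
    HasCompactSupport.intro hgc fun _ => stripAmplitude_eq_zero t x
  have hy : ∀ i, deriv (deriv (fun h => stripMode ε g w l t (Function.update y i h) x)) (y i) =
      cosTransform m (fun ξ => -((2 * π * ξ i) ^ 2) * stripAmplitude ε g l q t x ξ) y :=
    fun i => deriv_deriv_cosTransform_update hA hAc y i
  have hyI : ∀ i, Integrable fun ξ : EuclideanSpace ℝ (Fin m) =>
      -((2 * π * ξ i) ^ 2) * stripAmplitude ε g l q t x ξ := fun i =>
    Continuous.integrable_of_hasCompactSupport (by fun_prop) hAc.mul_left
  have htI := integrable_stripAmplitude (ε := ε) hg hgc hl (q := fun ξ x => l ξ * q ξ x)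
    (by fun_prop) t x
  have hxI := integrable_stripAmplitude (ε := ε) hg hgc hl
    (q := fun ξ x => q' ξ x - q ξ x / (2 * ε)) (by fun_prop) t x
  have hxxI := integrable_stripAmplitude (ε := ε) hg hgc hl
    (q := fun ξ x => q'' ξ x - q' ξ x / (2 * ε) - (q' ξ x - q ξ x / (2 * ε)) / (2 * ε))
    (by fun_prop) t x
  have hsI := integrable_finsetSum Finset.univ fun i _ => hyI i
  rw [hx, hxx, Finset.sum_congr rfl fun i _ => hy i, ← cosTransform_sum hyI,
    ← cosTransform_add hsI hxxI, ← cosTransform_const_mul]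
  have ht : deriv (fun s => stripMode ε g w l s y x) t =
      cosTransform m (stripAmplitude ε g l (fun ξ x => l ξ * q ξ x) t x) y :=
    (hasDerivAt_stripMode_time hg hgc hw hl t y x).deriv
  rw [ht, ← cosTransform_add htI hxI, ← cosTransform_add (htI.fun_add hxI)
    ((hsI.fun_add hxxI).const_mul ε)]
  unfold cosTransform
  refine integral_eq_zero_of_ae (.of_forall fun ξ => ?_)
  by_cases hξ : g ξ = 0
  · simp [stripAmplitude, hξ]
  have hnorm : ‖ξ‖ ^ 2 = ∑ i, ξ i ^ 2 := EuclideanSpace.real_norm_sq_eq ξ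
  have hsum : ∑ i, -((2 * π * ξ i) ^ 2) * stripAmplitude ε g l q t x ξ =
      -((2 * π * ‖ξ‖) ^ 2) * stripAmplitude ε g l q t x ξ := by
    rw [← Finset.sum_mul, Finset.sum_neg_distrib, mul_pow _ ‖ξ‖, hnorm, Finset.mul_sum]
    simp only [mul_pow]
  beta_reduce
  rw [hsum]
  simp only [stripAmplitude, q, q', q'', hlw ξ hξ, Pi.zero_apply]
  field_simp
  ring

theorem stripMode_boundary_top (hε : 0 < ε) (hg : Continuous g) (hgc : HasCompactSupport g)
    (hw : Continuous w) (hl : Continuous l)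
    (hbc : ∀ ξ, g ξ ≠ 0 →
      (l ξ - 1 / (2 * ε)) * cos (w ξ / 2) = -(w ξ * sin (w ξ / 2)))
    (t : ℝ) (y : Fin m → ℝ) :
    ε * (deriv (fun s => stripMode ε g w l s y 0) t - deriv (fun x => stripMode ε g w l t y x) 0)
      - stripMode ε g w l t y 0 = 0 := by
  have hx : deriv (fun x => stripMode ε g w l t y x) 0 = _ :=
    (hasDerivAt_stripMode_normal hg hgc hw hl t y 0).deriv
  have ht : deriv (fun s => stripMode ε g w l s y 0) t = _ :=
    (hasDerivAt_stripMode_time hg hgc hw hl t y 0).deriv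
  have hI := integrable_stripAmplitude (ε := ε) hg hgc hl (q := fun ξ x => cos (w ξ * (x + 1 / 2)))
    (by fun_prop) t 0
  have htI := integrable_stripAmplitude (ε := ε) hg hgc hl
    (q := fun ξ x => l ξ * cos (w ξ * (x + 1 / 2)))
    (by fun_prop) t 0
  have hxI := integrable_stripAmplitude (ε := ε) hg hgc hl
    (q := fun ξ x => -sin (w ξ * (x + 1 / 2)) * w ξ - cos (w ξ * (x + 1 / 2)) / (2 * ε))
    (by fun_prop) t 0
  have hs : stripMode ε g w l t y 0 = cosTransform m
    (stripAmplitude ε g l (fun ξ x => cos (w ξ * (x + 1 / 2))) t 0) y := rfl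
  rw [hx, ht, hs, sub_eq_add_neg, sub_eq_add_neg, ← neg_one_mul, ← neg_one_mul (cosTransform _ _ _),
    ← cosTransform_const_mul, ← cosTransform_const_mul, ← cosTransform_add htI (hxI.const_mul _),
    ← cosTransform_const_mul, ← cosTransform_add ((htI.fun_add (hxI.const_mul _)).const_mul _)
      (hI.const_mul _)]
  unfold cosTransform
  refine integral_eq_zero_of_ae (.of_forall fun ξ => ?_)
  by_cases hξ : g ξ = 0
  · simp [stripAmplitude, hξ]
  have h := hbc ξ hξ
  simp only [stripAmplitude, Pi.zero_apply, zero_add, mul_one_div, zero_div,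
    sub_zero]
  field_simp at h ⊢
  linear_combination g ξ * exp (l ξ * t) * cos (2 * π * ∑ i, ξ i * y i) * h

theorem stripMode_boundary_bottom (hg : Continuous g) (hgc : HasCompactSupport g)
    (hw : Continuous w) (hl : Continuous l)
    (hbc : ∀ ξ, g ξ ≠ 0 →
      (l ξ - 1 / (2 * ε)) * cos (w ξ / 2) = -(w ξ * sin (w ξ / 2)))
    (t : ℝ) (y : Fin m → ℝ) :
    deriv (fun s => stripMode ε g w l s y (-1)) t
      + deriv (fun x => stripMode ε g w l t y x) (-1) = 0 := by
  have hx : deriv (fun x => stripMode ε g w l t y x) (-1) = _ :=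
    (hasDerivAt_stripMode_normal hg hgc hw hl t y (-1)).deriv
  have ht : deriv (fun s => stripMode ε g w l s y (-1)) t = _ :=
    (hasDerivAt_stripMode_time hg hgc hw hl t y (-1)).deriv
  have htI := integrable_stripAmplitude (ε := ε) hg hgc hl
    (q := fun ξ x => l ξ * cos (w ξ * (x + 1 / 2)))
    (by fun_prop) t (-1)
  have hxI := integrable_stripAmplitude (ε := ε) hg hgc hl
    (q := fun ξ x => -sin (w ξ * (x + 1 / 2)) * w ξ - cos (w ξ * (x + 1 / 2)) / (2 * ε))
    (by fun_prop) t (-1)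
  rw [hx, ht, ← cosTransform_add htI hxI]
  unfold cosTransform
  refine integral_eq_zero_of_ae (.of_forall fun ξ => ?_)
  by_cases hξ : g ξ = 0
  · simp [stripAmplitude, hξ]
  have h := hbc ξ hξ
  have e : w ξ * (-1 + 1 / 2) = -(w ξ / 2) := by ring
  simp only [stripAmplitude, Pi.zero_apply, e, cos_neg, sin_neg]
  linear_combination g ξ * exp (l ξ * t - -1 / (2 * ε)) * cos (2 * π * ∑ i, ξ i * y i) * h

theorem integral_sq_stripMode (hg : ContDiff ℝ ∞ g) (hgc : HasCompactSupport g)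
    (hw : ContDiff ℝ ∞ w) (hl : ContDiff ℝ ∞ l) (hg_even : ∀ ξ, g (-ξ) = g ξ)
    (hw_even : ∀ ξ, w (-ξ) = w ξ) (hl_even : ∀ ξ, l (-ξ) = l ξ) (t x : ℝ) :
    Integrable (fun y => stripMode ε g w l t y x ^ 2) ∧
      ∫ y, stripMode ε g w l t y x ^ 2 =
        ∫ ξ, stripAmplitude ε g l (fun ξ x => cos (w ξ * (x + 1 / 2))) t x ξ ^ 2 :=
  integral_sq_cosTransform
    ((contDiff_stripAmplitude hg hw hl).comp (contDiff_const (c := (t, x)).prodMk contDiff_id))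
    (HasCompactSupport.intro hgc fun _ => stripAmplitude_eq_zero t x)
    (fun ξ => by simp [stripAmplitude, hg_even, hw_even, hl_even])

theorem continuous_integral_sq_stripAmplitude (hg : ContDiff ℝ ∞ g) (hgc : HasCompactSupport g)
    (hw : ContDiff ℝ ∞ w) (hl : ContDiff ℝ ∞ l) :
    Continuous (fun p : ℝ × ℝ =>
      ∫ ξ, stripAmplitude ε g l (fun ξ x => cos (w ξ * (x + 1 / 2))) p.1 p.2 ξ ^ 2) :=
  (contDiff_integral_of_compact_support (P := ℝ × ℝ)
    (K := fun p ξ => stripAmplitude ε g l (fun ξ x => cos (w ξ * (x + 1 / 2))) p.1 p.2 ξ ^ 2) hgc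
    (fun p ξ hξ => by simp [stripAmplitude_eq_zero _ _ hξ])
    ((contDiff_stripAmplitude hg hw hl).pow 2)).continuous

theorem integrable_sq_stripMode (hg : ContDiff ℝ ∞ g) (hgc : HasCompactSupport g)
    (hw : ContDiff ℝ ∞ w) (hl : ContDiff ℝ ∞ l) (hg_even : ∀ ξ, g (-ξ) = g ξ)
    (hw_even : ∀ ξ, w (-ξ) = w ξ) (hl_even : ∀ ξ, l (-ξ) = l ξ) (t : ℝ) :
    Integrable (fun p : (Fin m → ℝ) × ℝ => stripMode ε g w l t p.1 p.2 ^ 2)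
      (volume.restrict ((univ : Set (Fin m → ℝ)) ×ˢ Ioo (-1 : ℝ) 0)) := by
  have hcont : Continuous (fun p : (Fin m → ℝ) × ℝ => stripMode ε g w l t p.1 p.2 ^ 2) :=
    ((contDiff_stripMode hg hgc hw hl).continuous.comp
      (by fun_prop : Continuous fun p : (Fin m → ℝ) × ℝ => (t, p.1, p.2))).pow 2
  have hsq := integral_sq_stripMode (ε := ε) hg hgc hw hl hg_even hw_even hl_even t
  rw [Measure.volume_eq_prod, ← Measure.prod_restrict, Measure.restrict_univ,
    integrable_prod_iff' hcont.aestronglyMeasurable]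
  refine ⟨.of_forall fun x => (hsq x).1, ?_⟩
  simp only [norm_pow, norm_eq_abs, sq_abs, (hsq _).2]
  have := (continuous_integral_sq_stripAmplitude (ε := ε) hg hgc hw hl).comp
    (by fun_prop : Continuous fun x : ℝ => (t, x))
  exact (this.integrableOn_Icc (a := -1) (b := 0)).mono_set Ioo_subset_Icc_self

end StripMode

theorem exists_stripMode (m : ℕ) {ε : ℝ} (hε : 0 < ε) :
    ∃ g w l : EuclideanSpace ℝ (Fin m) → ℝ, ContDiff ℝ ∞ g ∧ HasCompactSupport g ∧
      ContDiff ℝ ∞ w ∧ ContDiff ℝ ∞ l ∧ (∀ ξ, g (-ξ) = g ξ) ∧ (∀ ξ, w (-ξ) = w ξ) ∧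
      (∀ ξ, l (-ξ) = l ξ) ∧ g 0 ≠ 0 ∧
      ∀ ξ, g ξ ≠ 0 → w ξ ∈ Ioo 0 π ∧
        l ξ = 1 / (4 * ε) + ε * (w ξ ^ 2 + (2 * π * ‖ξ‖) ^ 2) ∧
        (l ξ - 1 / (2 * ε)) * cos (w ξ / 2) = -(w ξ * sin (w ξ / 2)) := by
  obtain ⟨W, hW, δ, hδ, hWδ⟩ := exists_smooth_dispersion_branch hε
  have hρ : 0 < √δ / (2 * π) := by positivity
  let g : ContDiffBump (0 : EuclideanSpace ℝ (Fin m)) :=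
    ⟨√δ / (2 * π) / 2, √δ / (2 * π), by positivity, by linarith⟩
  have hs : ContDiff ℝ ∞ (fun ξ : EuclideanSpace ℝ (Fin m) => (2 * π * ‖ξ‖) ^ 2) := by
    simp only [mul_pow _ ‖_‖]
    exact contDiff_const.mul (contDiff_norm_sq ℝ)
  refine ⟨g, fun ξ => W ((2 * π * ‖ξ‖) ^ 2),
    fun ξ => 1 / (4 * ε) + ε * (W ((2 * π * ‖ξ‖) ^ 2) ^ 2 + (2 * π * ‖ξ‖) ^ 2),
    g.contDiff, g.hasCompactSupport, hW.comp hs,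
    contDiff_const.add (contDiff_const.mul (((hW.comp hs).pow 2).add hs)), fun ξ => g.neg ξ,
    fun ξ => by simp, fun ξ => by simp, ?_, fun ξ hξ => ?_⟩
  · rw [g.one_of_mem_closedBall (by simpa [g] using (half_pos hρ).le)]
    exact one_ne_zero
  · have hξ' : ‖ξ‖ < √δ / (2 * π) := by
      have : ξ ∈ Function.support g := hξ
      rw [g.support_eq] at this
      simpa using this
    have hlt : |(2 * π * ‖ξ‖) ^ 2| < δ := by
      rw [abs_of_nonneg (by positivity), ← Real.sq_sqrt hδ.le]
      refine pow_lt_pow_left₀ ?_ (by positivity) two_ne_zero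
      rwa [lt_div_iff₀' (by positivity)] at hξ'
    obtain ⟨h1, h2⟩ := hWδ _ hlt
    refine ⟨h1, rfl, ?_⟩
    rw [← h2]
    congr 1
    field_simp
    ring

theorem mul_exp_le_of_lt_one {T ε : ℝ} (hT : 0 < T) (hT1 : T < 1) (hε : 0 < ε) (hε1 : ε < 1) :
    ((1 - T) / 4 * exp ((1 - T) / 4 / ε)) ^ 2 * (T * exp (T / ε)) ≤ ε * exp (1 / ε) := by
  set z := (1 - T) / (2 * ε) with hz
  have hz0 : 0 < z := by have := sub_pos.2 hT1; positivity
  have hzε : 1 - T = 2 * ε * z := by rw [hz]; field_simp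
  have e1 : exp ((1 - T) / 4 / ε) ^ 2 = exp z := by
    rw [← exp_nat_mul]; congr 1; rw [hz]; field_simp; ring
  have e2 : exp (1 / ε) = exp z * exp z * exp (T / ε) := by
    rw [← exp_add, ← exp_add]; congr 1; rw [hz]; field_simp; ring
  have hexp := quadratic_le_exp_of_nonneg hz0.le
  rw [mul_pow, e1, e2]
  have key : ((1 - T) / 4) ^ 2 * T ≤ ε * exp z := by
    have h1 : ((1 - T) / 4) ^ 2 * T ≤ ((1 - T) / 4) ^ 2 := mul_le_of_le_one_right (sq_nonneg _) hT1.le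
    have h2 : ((1 - T) / 4) ^ 2 = ε * (ε * (z ^ 2 / 4)) := by rw [hzε]; ring
    have h3 : ε * (z ^ 2 / 4) ≤ 1 * (z ^ 2 / 4) :=
      mul_le_mul_of_nonneg_right hε1.le (by positivity)
    rw [h2] at h1 ⊢
    refine h1.trans (mul_le_mul_of_nonneg_left ?_ hε.le)
    nlinarith
  have := mul_le_mul_of_nonneg_right key (by positivity : 0 ≤ exp z * exp (T / ε))
  linarith

section Comparison

variable {m : ℕ} {ε : ℝ} {g w l : EuclideanSpace ℝ (Fin m) → ℝ}

theorem isAdjSolND_stripMode (hε : 0 < ε) (hg : ContDiff ℝ ∞ g) (hgc : HasCompactSupport g)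
    (hw : ContDiff ℝ ∞ w) (hl : ContDiff ℝ ∞ l) (hg_even : ∀ ξ, g (-ξ) = g ξ)
    (hw_even : ∀ ξ, w (-ξ) = w ξ) (hl_even : ∀ ξ, l (-ξ) = l ξ)
    (hlw : ∀ ξ, g ξ ≠ 0 → l ξ = 1 / (4 * ε) + ε * (w ξ ^ 2 + (2 * π * ‖ξ‖) ^ 2))
    (hbc : ∀ ξ, g ξ ≠ 0 → (l ξ - 1 / (2 * ε)) * cos (w ξ / 2) = -(w ξ * sin (w ξ / 2)))
    (T : ℝ) : IsAdjSolND m T ε (stripMode ε g w l) :=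
  ⟨contDiff_stripMode hg hgc hw hl,
    fun t _ => ⟨integrable_sq_stripMode hg hgc hw hl hg_even hw_even hl_even t,
      (integral_sq_stripMode hg hgc hw hl hg_even hw_even hl_even t 0).1,
      (integral_sq_stripMode hg hgc hw hl hg_even hw_even hl_even t (-1)).1⟩,
    fun t _ y x _ => stripMode_pde hε hg.continuous hgc hw.continuous hl.continuous hlw t y x,
    fun t _ y => stripMode_boundary_top hε hg.continuous hgc hw.continuous hl.continuous hbc t y,
    fun t _ y => stripMode_boundary_bottom hg.continuous hgc hw.continuous hl.continuous hbc t y⟩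

theorem le_XnormSq_stripMode (hε : 0 < ε) (hg : ContDiff ℝ ∞ g) (hgc : HasCompactSupport g)
    (hw : ContDiff ℝ ∞ w) (hl : ContDiff ℝ ∞ l) (hg_even : ∀ ξ, g (-ξ) = g ξ)
    (hw_even : ∀ ξ, w (-ξ) = w ξ) (hl_even : ∀ ξ, l (-ξ) = l ξ) :
    ε * exp (1 / ε) * ∫ ξ, (g ξ * cos (w ξ / 2)) ^ 2 ≤
      XnormSq m ε (stripMode ε g w l 0) := by
  have hbot : ∫ y, stripMode ε g w l 0 y (-1) ^ 2 =
      exp (1 / ε) * ∫ ξ, (g ξ * cos (w ξ / 2)) ^ 2 := by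
    rw [(integral_sq_stripMode hg hgc hw hl hg_even hw_even hl_even 0 (-1)).2,
      ← MeasureTheory.integral_const_mul]
    congr 1
    funext ξ
    have e1 : w ξ * (-1 + 1 / 2) = -(w ξ / 2) := by ring
    have e2 : exp (1 / ε) = exp (l ξ * 0 - -1 / (2 * ε)) ^ 2 := by
      rw [← exp_nat_mul]; congr 1; field_simp; ring
    simp only [stripAmplitude, e1, cos_neg]
    rw [e2]
    ring
  have h1 : 0 ≤ ∫ p : (Fin m → ℝ) × ℝ in (univ : Set (Fin m → ℝ)) ×ˢ Ioo (-1 : ℝ) 0,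
      stripMode ε g w l 0 p.1 p.2 ^ 2 := MeasureTheory.integral_nonneg fun _ => sq_nonneg _
  have h2 : 0 ≤ ∫ y, stripMode ε g w l 0 y 0 ^ 2 :=
    MeasureTheory.integral_nonneg fun _ => sq_nonneg _
  rw [XnormSq, mul_assoc, ← hbot]
  nlinarith

theorem integral_sq_stripMode_top_le (hε : 0 < ε) (hg : ContDiff ℝ ∞ g) (hgc : HasCompactSupport g)
    (hw : ContDiff ℝ ∞ w) (hl : ContDiff ℝ ∞ l) (hg_even : ∀ ξ, g (-ξ) = g ξ)
    (hw_even : ∀ ξ, w (-ξ) = w ξ) (hl_even : ∀ ξ, l (-ξ) = l ξ)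
    (hlε : ∀ ξ, g ξ ≠ 0 → l ξ ≤ 1 / (2 * ε)) {t T : ℝ} (ht : t ∈ Icc 0 T) :
    ∫ y, stripMode ε g w l t y 0 ^ 2 ≤
      exp (T / ε) * ∫ ξ, (g ξ * cos (w ξ / 2)) ^ 2 := by
  rw [(integral_sq_stripMode hg hgc hw hl hg_even hw_even hl_even t 0).2,
    ← MeasureTheory.integral_const_mul]
  have hgC := hg.continuous
  have hwC := hw.continuous
  have hlC := hl.continuous
  have hzero : ∀ ξ, ξ ∉ tsupport g → g ξ = 0 := fun ξ => image_eq_zero_of_notMem_tsupport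
  refine integral_mono
    (Continuous.integrable_of_hasCompactSupport (by unfold stripAmplitude; fun_prop)
      (HasCompactSupport.intro hgc fun ξ hξ => by simp [stripAmplitude, hzero ξ hξ]))
    (Continuous.integrable_of_hasCompactSupport (by fun_prop)
      (HasCompactSupport.intro hgc fun ξ hξ => by simp [hzero ξ hξ])) fun ξ => ?_
  by_cases hξ : g ξ = 0
  · simp [stripAmplitude, hξ]
  have hle : exp (l ξ * t) ^ 2 ≤ exp (T / ε) := by
    rw [← exp_nat_mul, exp_le_exp]
    calc (2 : ℕ) * (l ξ * t) = 2 * (l ξ * t) := by norm_num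
      _ ≤ 2 * (1 / (2 * ε) * T) := by
        have := mul_le_mul_of_nonneg_right (hlε ξ hξ) ht.1
        have := mul_le_mul_of_nonneg_left ht.2 (by positivity : 0 ≤ 1 / (2 * ε))
        linarith
      _ = T / ε := by field_simp
  have := mul_le_mul_of_nonneg_right hle (sq_nonneg (g ξ * cos (w ξ / 2)))
  simp only [stripAmplitude, zero_add, zero_div, sub_zero, mul_one_div]
  linarith

end Comparison

/-- Observability form of Theorem 2 (blow-up of the control cost for small time):
for `T < 1` (recall `L = 1`), there are adjoint solutions whose initial `X`-norm
is exponentially large compared with the boundary observation. -/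
theorem observability_blowup_small_time (n : ℕ) (hn : 1 ≤ n) :
    ∀ T : ℝ, 0 < T → T < 1 →
      ∃ ε0 > (0:ℝ), ∃ C > (0:ℝ), ∃ k > (0:ℝ),
        ∀ ε ∈ Set.Ioo (0:ℝ) ε0, ∃ φ : ℝ → (Fin (n-1) → ℝ) → ℝ → ℝ,
          IsAdjSolND (n-1) T ε φ ∧
          0 < (∫ t in (0:ℝ)..T, ∫ x' : Fin (n-1) → ℝ, φ t x' 0 ^ 2) ∧
          C * Real.exp (k / ε) *
              Real.sqrt (∫ t in (0:ℝ)..T, ∫ x' : Fin (n-1) → ℝ, φ t x' 0 ^ 2) ≤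
            Real.sqrt (XnormSq (n-1) ε (φ 0)) := by
  intro T hT hT1
  refine ⟨1, one_pos, (1 - T) / 4, by linarith, (1 - T) / 4, by linarith, fun ε hε => ?_⟩
  obtain ⟨hε0, hε1⟩ := hε
  obtain ⟨g, w, l, hg, hgc, hw, hl, hg_even, hw_even, hl_even, hg0, hprop⟩ :=
    exists_stripMode (n - 1) hε0
  have hcos : ∀ ξ, g ξ ≠ 0 → 0 < cos (w ξ / 2) := fun ξ hξ =>
    cos_pos_of_mem_Ioo ⟨by linarith [(hprop ξ hξ).1.1, pi_pos], by linarith [(hprop ξ hξ).1.2]⟩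
  have hlε : ∀ ξ, g ξ ≠ 0 → l ξ ≤ 1 / (2 * ε) := fun ξ hξ => by
    obtain ⟨⟨hw0, hwπ⟩, -, hbc⟩ := hprop ξ hξ
    have hsin : 0 < sin (w ξ / 2) := sin_pos_of_pos_of_lt_pi (by linarith) (by linarith)
    by_contra! hlt
    have := mul_pos (sub_pos.2 hlt) (hcos ξ hξ)
    have := mul_pos hw0 hsin
    linarith
  refine ⟨stripMode ε g w l, isAdjSolND_stripMode hε0 hg hgc hw hl hg_even hw_even hl_even
    (fun ξ hξ => (hprop ξ hξ).2.1) (fun ξ hξ => (hprop ξ hξ).2.2) T, ?_, ?_⟩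
  all_goals
    have hsq := fun t =>
      (integral_sq_stripMode (ε := ε) hg hgc hw hl hg_even hw_even hl_even t 0).2
    have hcont : Continuous fun t => ∫ y, stripMode ε g w l t y 0 ^ 2 := by
      simp only [hsq]
      exact (continuous_integral_sq_stripAmplitude hg hgc hw hl).comp
        (by fun_prop : Continuous fun t : ℝ => (t, (0 : ℝ)))
  · refine intervalIntegral_pos_of_pos (hcont.intervalIntegrable _ _) (fun t => ?_) hT
    rw [hsq]
    have hgC := hg.continuous
    have hwC := hw.continuous
    have hlC := hl.continuous
    refine Continuous.integral_pos_of_hasCompactSupport_nonneg_nonzero (x := 0)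
      (by unfold stripAmplitude; fun_prop)
      (HasCompactSupport.intro hgc fun ξ hξ => by simp [stripAmplitude_eq_zero t 0 hξ])
      (fun ξ => sq_nonneg _) ?_
    have := (hcos 0 hg0).ne'
    simp only [stripAmplitude, zero_add, mul_one_div]
    positivity
  · set A := ∫ ξ, (g ξ * cos (w ξ / 2)) ^ 2
    have hA : 0 ≤ A := MeasureTheory.integral_nonneg fun _ => sq_nonneg _
    have hobs : ∫ t in (0 : ℝ)..T, ∫ y, stripMode ε g w l t y 0 ^ 2 ≤ T * (exp (T / ε) * A) := by
      have := intervalIntegral.integral_mono_on hT.le (hcont.intervalIntegrable (μ := volume) 0 T)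
        (continuous_const.intervalIntegrable (μ := volume) 0 T) fun t ht =>
          integral_sq_stripMode_top_le hε0 hg hgc hw hl hg_even hw_even hl_even hlε ht
      rwa [intervalIntegral.integral_const, sub_zero, smul_eq_mul] at this
    have hK : 0 ≤ (1 - T) / 4 * exp ((1 - T) / 4 / ε) :=
      mul_nonneg (by linarith) (exp_pos _).le
    rw [← Real.sqrt_sq hK, ← Real.sqrt_mul (sq_nonneg _)]
    refine Real.sqrt_le_sqrt (le_trans ?_
      (le_XnormSq_stripMode hε0 hg hgc hw hl hg_even hw_even hl_even))
    have h1 := mul_le_mul_of_nonneg_left hobs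
      (sq_nonneg ((1 - T) / 4 * exp ((1 - T) / 4 / ε)))
    have h2 := mul_le_mul_of_nonneg_right (mul_exp_le_of_lt_one hT hT1 hε0 hε1) hA
    linarith
end
end

section
/- Observability form of Proposition 1.1 (one-dimensional problem with parameter): There exists T0 > 0 such that for every T ≥ T0 there exist ε0 > 0 and constants C > 0, k > 0, independent of a and ε, such that for every a ≥ 0, every ε ∈ (0, ε0), and every classical solution φ of the one-dimensional adjoint system (S'^a), one has ‖φ(0,·)‖_{X¹} ≤ C e^{−k/ε} ( ∫_0^T |φ(t,0)|² dt )^{1/2}. -/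
open Real MeasureTheory intervalIntegral Set

noncomputable section

/-- A classical solution of the one-dimensional adjoint system `(S'^a)`:
`φ ∈ C^∞`, satisfying `∂_t φ + ∂_x φ + ε ∂_x² φ − a φ = 0` on `Q = (0,T)×(−1,0)`,
the boundary condition `ε(∂_t φ(t,0) − ∂_x φ(t,0)) − φ(t,0) = 0` and
`∂_t φ(t,−1) + ∂_x φ(t,−1) = 0` for `t ∈ (0,T)`. -/
def IsAdjSol1D (T ε a : ℝ) (φ : ℝ → ℝ → ℝ) : Prop :=
  ContDiff ℝ (⊤ : ℕ∞) (fun p : ℝ × ℝ => φ p.1 p.2) ∧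
  (∀ t ∈ Set.Ioo (0:ℝ) T, ∀ x ∈ Set.Ioo (-1:ℝ) 0,
    deriv (fun s => φ s x) t + deriv (fun y => φ t y) x
      + ε * deriv (deriv (fun y => φ t y)) x - a * φ t x = 0) ∧
  (∀ t ∈ Set.Ioo (0:ℝ) T,
    ε * (deriv (fun s => φ s 0) t - deriv (fun y => φ t y) 0) - φ t 0 = 0) ∧
  (∀ t ∈ Set.Ioo (0:ℝ) T,
    deriv (fun s => φ s (-1)) t + deriv (fun y => φ t y) (-1) = 0)

/-- The squared `X¹`-norm: `‖ψ‖²_{X¹} = ∫_{−1}^0 |ψ|² + ε(|ψ(0)|² + |ψ(−1)|²)`. -/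
def X1normSq (ε : ℝ) (ψ : ℝ → ℝ) : ℝ :=
  (∫ x in (-1:ℝ)..0, ψ x ^ 2) + ε * (ψ 0 ^ 2 + ψ (-1) ^ 2)

/-! ### A flat function with factorially controlled derivatives -/

/-- `s ↦ s⁻ᵖ e^{-N/s}` on `(0,∞)`, extended by zero. -/
def expInvPow (N : ℝ) (p : ℕ) (s : ℝ) : ℝ :=
  if 0 < s then s⁻¹ ^ p * Real.exp (-N / s) else 0

lemma expInvPow_of_nonpos (N : ℝ) (p : ℕ) {s : ℝ} (hs : s ≤ 0) : expInvPow N p s = 0 :=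
  if_neg hs.not_gt

lemma expInvPow_nonneg (N : ℝ) (p : ℕ) (s : ℝ) : 0 ≤ expInvPow N p s := by
  unfold expInvPow
  split_ifs with h
  · positivity
  · exact le_rfl

lemma expInvPow_le {N : ℝ} (hN : 0 < N) (p : ℕ) (s : ℝ) :
    expInvPow N p s ≤ p.factorial / N ^ p := by
  unfold expInvPow
  split_ifs with h
  · have h1 := Real.pow_div_factorial_le_exp (N / s) (by positivity) p
    rw [div_le_iff₀ (by positivity)] at h1
    rw [le_div_iff₀ (by positivity), neg_div, Real.exp_neg]
    calc s⁻¹ ^ p * (Real.exp (N / s))⁻¹ * N ^ p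
        = (N / s) ^ p * (Real.exp (N / s))⁻¹ := by rw [div_eq_mul_inv N s, mul_pow]; ring
      _ ≤ Real.exp (N / s) * p.factorial * (Real.exp (N / s))⁻¹ := by gcongr
      _ = p.factorial := by field_simp
  · positivity

lemma expInvPow_eq_pow_mul (N : ℝ) (p q : ℕ) (s : ℝ) :
    expInvPow N p s = s ^ q * expInvPow N (p + q) s := by
  unfold expInvPow
  split_ifs with h
  · rw [pow_add, inv_pow s q]
    field_simp
  · simp

lemma hasDerivAt_expInvPow {N : ℝ} (hN : 0 < N) (p : ℕ) (s : ℝ) :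
    HasDerivAt (expInvPow N p)
      (-(p : ℝ) * expInvPow N (p + 1) s + N * expInvPow N (p + 2) s) s := by
  rcases lt_trichotomy s 0 with hs | rfl | hs
  · rw [expInvPow_of_nonpos _ _ hs.le, expInvPow_of_nonpos _ _ hs.le]
    have : expInvPow N p =ᶠ[nhds s] fun _ => 0 := by
      filter_upwards [Iio_mem_nhds hs] with y hy
      exact expInvPow_of_nonpos _ _ (le_of_lt hy)
    simpa using (hasDerivAt_const s (0 : ℝ)).congr_of_eventuallyEq this
  · rw [expInvPow_of_nonpos _ _ le_rfl, expInvPow_of_nonpos _ _ le_rfl]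
    simp only [mul_zero, add_zero]
    rw [hasDerivAt_iff_isLittleO]
    simp only [expInvPow_of_nonpos N p le_rfl, sub_zero, smul_zero]
    have h1 : (fun x : ℝ => expInvPow N p x) =O[nhds 0] fun x => x ^ 2 := by
      refine Asymptotics.IsBigO.of_bound ((p + 2).factorial / N ^ (p + 2)) ?_
      filter_upwards with x
      rw [expInvPow_eq_pow_mul N p 2 x, norm_mul, mul_comm,
        Real.norm_of_nonneg (expInvPow_nonneg _ _ _)]
      gcongr
      exact expInvPow_le hN _ _
    refine h1.trans_isLittleO ?_
    simpa using Asymptotics.isLittleO_pow_pow (𝕜 := ℝ) (m := 1) (n := 2) (by norm_num)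
  · have e : expInvPow N p =ᶠ[nhds s] fun y => y⁻¹ ^ p * Real.exp (-N / y) := by
      filter_upwards [Ioi_mem_nhds hs] with y hy
      exact if_pos hy
    refine HasDerivAt.congr_of_eventuallyEq ?_ e
    have h1 := ((hasDerivAt_inv hs.ne').pow p).mul
      (((hasDerivAt_inv hs.ne').const_mul (-N)).exp)
    simp only [expInvPow, if_pos hs, div_eq_mul_inv]
    refine h1.congr_deriv ?_
    rcases p with _ | p
    · simp; field_simp
    · simp; field_simp; ring

lemma contDiff_expInvPow {N : ℝ} (hN : 0 < N) (p : ℕ) : ContDiff ℝ (⊤ : ℕ∞) (expInvPow N p) := by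
  rw [contDiff_infty]
  intro n
  induction n generalizing p with
  | zero =>
    exact contDiff_zero.2
      (continuous_iff_continuousAt.2 fun s => (hasDerivAt_expInvPow hN p s).continuousAt)
  | succ n ih =>
    push_cast
    refine contDiff_succ_iff_deriv.2
      ⟨fun s => (hasDerivAt_expInvPow hN p s).differentiableAt, by simp, ?_⟩
    rw [funext fun s => (hasDerivAt_expInvPow hN p s).deriv]
    exact (contDiff_const.mul (ih _)).add (contDiff_const.mul (ih _))

lemma abs_iteratedDeriv_expInvPow_le {N : ℝ} (hN : 0 < N) (j p : ℕ) (s : ℝ) :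
    |iteratedDeriv j (expInvPow N p) s| ≤ 2 ^ j * (p + 2 * j).factorial / N ^ (p + j) := by
  induction j generalizing p with
  | zero =>
    simpa [abs_of_nonneg (expInvPow_nonneg N p s)] using expInvPow_le hN p s
  | succ j ih =>
    have hc : ∀ q, ContDiffAt ℝ j (expInvPow N q) s := fun q =>
      ((contDiff_expInvPow hN q).of_le (by exact_mod_cast le_top)).contDiffAt
    rw [iteratedDeriv_succ', funext fun s => (hasDerivAt_expInvPow hN p s).deriv,
      iteratedDeriv_fun_add (contDiffAt_const.mul (hc _)) (contDiffAt_const.mul (hc _)),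
      iteratedDeriv_const_mul _ (hc _), iteratedDeriv_const_mul _ (hc _)]
    have h1 := ih (p + 1)
    have h2 := ih (p + 2)
    have h3 : (p : ℝ) * (p + 1 + 2 * j).factorial ≤ (p + 2 * (j + 1)).factorial := by
      have : p + 2 * (j + 1) = (p + 1 + 2 * j) + 1 := by ring
      rw [this, Nat.factorial_succ]
      have : p * (p + 1 + 2 * j).factorial ≤ (p + 1 + 2 * j + 1) * (p + 1 + 2 * j).factorial := by
        gcongr; omega
      exact_mod_cast this
    calc |-(p : ℝ) * iteratedDeriv j (expInvPow N (p + 1)) s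
          + N * iteratedDeriv j (expInvPow N (p + 2)) s|
        ≤ p * |iteratedDeriv j (expInvPow N (p + 1)) s|
          + N * |iteratedDeriv j (expInvPow N (p + 2)) s| := by
          refine (abs_add_le _ _).trans_eq ?_
          rw [abs_mul, abs_mul, abs_neg, Nat.abs_cast, abs_of_pos hN]
      _ ≤ p * (2 ^ j * (p + 1 + 2 * j).factorial / N ^ (p + 1 + j))
          + N * (2 ^ j * (p + 2 + 2 * j).factorial / N ^ (p + 2 + j)) := by gcongr
      _ = 2 ^ j * (p * (p + 1 + 2 * j).factorial) / N ^ (p + (j + 1))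
          + 2 ^ j * (p + 2 * (j + 1)).factorial / N ^ (p + (j + 1)) := by
          have e1 : p + 2 + 2 * j = p + 2 * (j + 1) := by ring
          have e2 : p + 2 + j = p + (j + 1) + 1 := by ring
          have e3 : p + 1 + j = p + (j + 1) := by ring
          rw [e1, e2, e3, pow_succ N]
          field_simp
      _ ≤ 2 ^ j * (p + 2 * (j + 1)).factorial / N ^ (p + (j + 1))
          + 2 ^ j * (p + 2 * (j + 1)).factorial / N ^ (p + (j + 1)) := by gcongr
      _ = _ := by rw [pow_succ 2 j]; ring

/-! ### Functions of Gevrey order two -/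

/-- `g` is smooth with `|g⁽ᵏ⁾| ≤ M rᵏ (2 * k)!` on the set `S`. -/
def GevreyTwoOn (M r : ℝ) (g : ℝ → ℝ) (S : Set ℝ) : Prop :=
  ContDiff ℝ (⊤ : ℕ∞) g ∧
    ∀ k : ℕ, ∀ s ∈ S, |iteratedDeriv k g s| ≤ M * r ^ k * (2 * k).factorial

lemma GevreyTwoOn.mul {M₁ M₂ r : ℝ} {f g : ℝ → ℝ} {S : Set ℝ} (hr : 0 ≤ r) (hM₁ : 0 ≤ M₁)
    (hM₂ : 0 ≤ M₂) (hf : GevreyTwoOn M₁ r f S) (hg : GevreyTwoOn M₂ r g S) :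
    GevreyTwoOn (M₁ * M₂) (2 * r) (fun s => f s * g s) S := by
  refine ⟨hf.1.mul hg.1, fun k s hs => ?_⟩
  rw [iteratedDeriv_fun_mul (hf.1.of_le (by exact_mod_cast le_top)).contDiffAt
    (hg.1.of_le (by exact_mod_cast le_top)).contDiffAt]
  calc _ ≤ ∑ i ∈ Finset.range (k + 1),
          (k.choose i : ℝ) * (M₁ * M₂ * r ^ k * (2 * k).factorial) := by
        refine (Finset.abs_sum_le_sum_abs _ _).trans (Finset.sum_le_sum fun i hi => ?_)
        have hi : i ≤ k := Nat.lt_succ_iff.1 (Finset.mem_range.1 hi)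
        rw [abs_mul, abs_mul, Nat.abs_cast, mul_assoc]
        refine mul_le_mul_of_nonneg_left ?_ (Nat.cast_nonneg _)
        have h1 : (((2 * i).factorial * (2 * (k - i)).factorial : ℕ) : ℝ) ≤ (2 * k).factorial := by
          have := Nat.le_of_dvd (Nat.factorial_pos _)
            (Nat.factorial_mul_factorial_dvd_factorial_add (2 * i) (2 * (k - i)))
          rw [show 2 * i + 2 * (k - i) = 2 * k by omega] at this
          exact_mod_cast this
        push_cast at h1
        calc _ ≤ (M₁ * r ^ i * (2 * i).factorial) * (M₂ * r ^ (k - i) * (2 * (k - i)).factorial) :=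
              mul_le_mul (hf.2 i s hs) (hg.2 (k - i) s hs) (abs_nonneg _) (by positivity)
          _ = M₁ * M₂ * r ^ k * ((2 * i).factorial * (2 * (k - i)).factorial) := by
              rw [← pow_mul_pow_sub r hi]; ring
          _ ≤ _ := mul_le_mul_of_nonneg_left h1 (by positivity)
    _ = _ := by
        rw [← Finset.sum_mul, ← Nat.cast_sum, Nat.sum_range_choose, mul_pow]
        push_cast
        ring

lemma gevreyTwoOn_expInvPow {N : ℝ} (hN : 0 < N) (S : Set ℝ) :
    GevreyTwoOn 1 (2 / N) (expInvPow N 0) S := by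
  refine ⟨contDiff_expInvPow hN 0, fun k s _ => ?_⟩
  refine (abs_iteratedDeriv_expInvPow_le hN k 0 s).trans_eq ?_
  rw [div_pow]
  simp
  ring

lemma GevreyTwoOn.comp_const_sub {M r c : ℝ} {g : ℝ → ℝ} {S S' : Set ℝ}
    (hg : GevreyTwoOn M r g S) (hS : ∀ s ∈ S', c - s ∈ S) :
    GevreyTwoOn M r (fun s => g (c - s)) S' := by
  refine ⟨hg.1.comp (contDiff_const.sub contDiff_id), fun k s hs => ?_⟩
  rw [iteratedDeriv_comp_const_sub]
  simp only [smul_eq_mul]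
  rw [abs_mul, abs_pow, abs_neg, abs_one, one_pow,
    one_mul]
  exact hg.2 k _ (hS s hs)

/-- The symmetric bump `e^{-N/s - N/(1-s)}` supported in `[0,1]`. -/
def flatBump (N s : ℝ) : ℝ := expInvPow N 0 s * expInvPow N 0 (1 - s)

lemma gevreyTwoOn_flatBump {N : ℝ} (hN : 0 < N) (S : Set ℝ) :
    GevreyTwoOn 1 (4 / N) (flatBump N) S := by
  have h := GevreyTwoOn.mul (by positivity) zero_le_one zero_le_one (gevreyTwoOn_expInvPow hN S)
    ((gevreyTwoOn_expInvPow hN univ).comp_const_sub (c := 1) (S' := S) fun _ _ => mem_univ _)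
  rwa [one_mul, show 2 * (2 / N) = 4 / N by ring] at h

lemma flatBump_nonneg (N s : ℝ) : 0 ≤ flatBump N s :=
  mul_nonneg (expInvPow_nonneg _ _ _) (expInvPow_nonneg _ _ _)

lemma flatBump_eq_zero {N s : ℝ} (hs : s ∉ Ioo (0 : ℝ) 1) : flatBump N s = 0 := by
  unfold flatBump
  rcases le_or_gt s 0 with h | h
  · rw [expInvPow_of_nonpos _ _ h, zero_mul]
  · rw [expInvPow_of_nonpos _ _ (s := 1 - s), mul_zero]
    by_contra h'
    exact hs ⟨h, by linarith⟩

lemma le_integral_flatBump {N : ℝ} (hN : 0 < N) :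
    Real.exp (-(6 * N)) / 2 ≤ ∫ s in (0 : ℝ)..1, flatBump N s := by
  have hc : Continuous (flatBump N) := (gevreyTwoOn_flatBump hN univ).1.continuous
  have h1 : ∀ s ∈ Icc (1 / 4 : ℝ) (3 / 4), Real.exp (-(6 * N)) ≤ flatBump N s := by
    rintro s ⟨h0, h1⟩
    unfold flatBump expInvPow
    rw [if_pos (by linarith), if_pos (by linarith), pow_zero, pow_zero, one_mul, one_mul,
      ← Real.exp_add]
    refine Real.exp_le_exp.2 ?_
    have h2 : -N / s + -N / (1 - s) = -(N / (s * (1 - s))) := by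
      have : s ≠ 0 := by linarith
      have : 1 - s ≠ 0 := by linarith
      field_simp
      ring
    rw [h2, neg_le_neg_iff, div_le_iff₀ (by nlinarith)]
    nlinarith [mul_nonneg (sub_nonneg.2 h0) (sub_nonneg.2 h1)]
  calc Real.exp (-(6 * N)) / 2 = ∫ s in (1 / 4 : ℝ)..(3 / 4), Real.exp (-(6 * N)) := by
        rw [intervalIntegral.integral_const, smul_eq_mul]; ring
    _ ≤ ∫ s in (1 / 4 : ℝ)..(3 / 4), flatBump N s :=
        intervalIntegral.integral_mono_on (by norm_num) (by simp) (hc.intervalIntegrable _ _) h1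
    _ ≤ _ := intervalIntegral.integral_mono_interval (by norm_num) (by norm_num) (by norm_num)
        (Filter.Eventually.of_forall fun s => flatBump_nonneg N s) (hc.intervalIntegrable _ _)

/-! ### A comparison argument in the space variable -/

lemma exp_mul_le_of_deriv_ge {f f' : ℝ → ℝ} {c : ℝ}
    (hf : ∀ X ∈ Icc (0 : ℝ) 1, HasDerivAt f (f' X) X) (h : ∀ X ∈ Icc (0 : ℝ) 1, c * f X ≤ f' X)
    (h0 : 0 ≤ f 0) : ∀ X ∈ Icc (0 : ℝ) 1, 0 ≤ f X := by
  intro X hX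
  have hd : ∀ Y ∈ Icc (0 : ℝ) 1, HasDerivAt (fun Y => Real.exp (-(c * Y)) * f Y)
      (Real.exp (-(c * Y)) * (f' Y - c * f Y)) Y := by
    intro Y hY
    have := (((hasDerivAt_id Y).const_mul c).neg.exp).mul (hf Y hY)
    refine this.congr_deriv ?_
    simp
    ring
  have hm : MonotoneOn (fun Y => Real.exp (-(c * Y)) * f Y) (Icc (0 : ℝ) 1) := by
    refine monotoneOn_of_deriv_nonneg (convex_Icc _ _)
      (fun Y hY => (hd Y hY).continuousAt.continuousWithinAt)
      (fun Y hY => (hd Y (interior_subset hY)).differentiableAt.differentiableWithinAt)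
      fun Y hY => ?_
    rw [(hd Y (interior_subset hY)).deriv]
    exact mul_nonneg (Real.exp_pos _).le (sub_nonneg.2 (h Y (interior_subset hY)))
  have h1 := hm (left_mem_Icc.2 zero_le_one) hX hX.1
  simp only [mul_zero, neg_zero, Real.exp_zero, one_mul] at h1
  exact nonneg_of_mul_nonneg_right (h0.trans h1) (Real.exp_pos _)

lemma nonneg_of_second_deriv_ge {f f' f'' : ℝ → ℝ} {Λ : ℝ} (hΛ : 0 ≤ Λ)
    (hf : ∀ X ∈ Icc (0 : ℝ) 1, HasDerivAt f (f' X) X)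
    (hf' : ∀ X ∈ Icc (0 : ℝ) 1, HasDerivAt f' (f'' X) X)
    (h : ∀ X ∈ Icc (0 : ℝ) 1, Λ ^ 2 * f X ≤ f'' X) (h0 : 0 ≤ f 0) (h0' : 0 ≤ f' 0) :
    ∀ X ∈ Icc (0 : ℝ) 1, 0 ≤ f X := by
  have h1 := exp_mul_le_of_deriv_ge (f := fun X => f' X + Λ * f X) (c := Λ)
    (fun X hX => (hf' X hX).add ((hf X hX).const_mul Λ))
    (fun X hX => by nlinarith [h X hX]) (by positivity)
  exact exp_mul_le_of_deriv_ge (c := -Λ) hf (fun X hX => by linarith [h1 X hX]) h0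

/-- Majorant used in the space-like Cauchy problem. -/
def majorant (ε Λ : ℝ) (k : ℕ) (X : ℝ) : ℝ :=
  (ε / 8) ^ k * (2 * k + 1).factorial * (Real.exp (Λ * X) * (1 - X / 2)⁻¹ ^ (2 * k + 2))

/-- Derivative of `majorant`. -/
def majorantDeriv (ε Λ : ℝ) (k : ℕ) (X : ℝ) : ℝ :=
  (ε / 8) ^ k * (2 * k + 1).factorial * (Real.exp (Λ * X) *
    (Λ * (1 - X / 2)⁻¹ ^ (2 * k + 2) + (k + 1) * (1 - X / 2)⁻¹ ^ (2 * k + 3)))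

/-- Second derivative of `majorant`. -/
def majorantDeriv₂ (ε Λ : ℝ) (k : ℕ) (X : ℝ) : ℝ :=
  (ε / 8) ^ k * (2 * k + 1).factorial * (Real.exp (Λ * X) *
    (Λ ^ 2 * (1 - X / 2)⁻¹ ^ (2 * k + 2) + 2 * Λ * (k + 1) * (1 - X / 2)⁻¹ ^ (2 * k + 3)
      + (k + 1) * (k + 3 / 2) * (1 - X / 2)⁻¹ ^ (2 * k + 4)))

lemma hasDerivAt_inv_one_sub_half_pow (n : ℕ) {X : ℝ} (hX : X ∈ Icc (0 : ℝ) 1) :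
    HasDerivAt (fun X : ℝ => (1 - X / 2)⁻¹ ^ n) (n / 2 * (1 - X / 2)⁻¹ ^ (n + 1)) X := by
  have hne : 1 - X / 2 ≠ 0 := by linarith [hX.2]
  have := ((((hasDerivAt_id X).div_const 2).const_sub 1).inv hne).pow n
  refine this.congr_deriv ?_
  rcases n with _ | n
  · simp
  · have hne' : 2 - X ≠ 0 := by linarith [hX.2]
    simp
    field_simp
    rw [div_pow, div_pow]
    field_simp
    ring

lemma hasDerivAt_exp_mul (Λ X : ℝ) :
    HasDerivAt (fun X : ℝ => Real.exp (Λ * X)) (Λ * Real.exp (Λ * X)) X := by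
  have := ((hasDerivAt_id X).const_mul Λ).exp
  refine this.congr_deriv ?_
  simp
  ring

lemma hasDerivAt_majorant (ε Λ : ℝ) (k : ℕ) {X : ℝ} (hX : X ∈ Icc (0 : ℝ) 1) :
    HasDerivAt (majorant ε Λ k) (majorantDeriv ε Λ k X) X := by
  have := ((hasDerivAt_exp_mul Λ X).mul (hasDerivAt_inv_one_sub_half_pow (2 * k + 2) hX)).const_mul
    ((ε / 8) ^ k * ((2 * k + 1).factorial : ℝ))
  refine this.congr_deriv ?_
  unfold majorantDeriv
  push_cast
  ring

lemma hasDerivAt_majorantDeriv (ε Λ : ℝ) (k : ℕ) {X : ℝ} (hX : X ∈ Icc (0 : ℝ) 1) :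
    HasDerivAt (majorantDeriv ε Λ k) (majorantDeriv₂ ε Λ k X) X := by
  have := ((hasDerivAt_exp_mul Λ X).mul
    (((hasDerivAt_inv_one_sub_half_pow (2 * k + 2) hX).const_mul Λ).add
      ((hasDerivAt_inv_one_sub_half_pow (2 * k + 3) hX).const_mul ((k : ℝ) + 1)))).const_mul
    ((ε / 8) ^ k * ((2 * k + 1).factorial : ℝ))
  refine this.congr_deriv ?_
  unfold majorantDeriv₂
  push_cast
  simp only [Pi.add_apply]
  ring

lemma majorant_pos {ε : ℝ} (hε : 0 < ε) (Λ : ℝ) (k : ℕ) {X : ℝ} (hX : X ∈ Icc (0 : ℝ) 1) :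
    0 < majorant ε Λ k X := by
  have : 0 < 1 - X / 2 := by linarith [hX.2]
  unfold majorant
  positivity

lemma le_majorantDeriv₂ {ε Λ : ℝ} (hε : 0 < ε) (hΛ : 0 ≤ Λ) (k : ℕ) {X : ℝ}
    (hX : X ∈ Icc (0 : ℝ) 1) :
    Λ ^ 2 * majorant ε Λ k X + 2 / ε * majorant ε Λ (k + 1) X ≤ majorantDeriv₂ ε Λ k X := by
  have h1 : 0 < 1 - X / 2 := by linarith [hX.2]
  have h2 : 2 / ε * majorant ε Λ (k + 1) X = (ε / 8) ^ k * (2 * k + 1).factorial *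
      (Real.exp (Λ * X) * ((k + 1) * (k + 3 / 2) * (1 - X / 2)⁻¹ ^ (2 * k + 4))) := by
    unfold majorant
    rw [show 2 * (k + 1) + 1 = (2 * k + 1) + 1 + 1 by ring, Nat.factorial_succ, Nat.factorial_succ,
      show 2 * (k + 1) + 2 = 2 * k + 4 by ring]
    push_cast
    field_simp
    ring
  have h3 : 0 ≤ (ε / 8) ^ k * (2 * k + 1).factorial * (Real.exp (Λ * X) *
      (2 * Λ * (k + 1) * (1 - X / 2)⁻¹ ^ (2 * k + 3))) := by positivity
  rw [h2]
  unfold majorantDeriv₂ majorant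
  linarith

lemma factorial_le_majorant {ε : ℝ} (hε : 0 < ε) {Λ : ℝ} (hΛ : 0 ≤ Λ) (k : ℕ) {X : ℝ}
    (hX : X ∈ Icc (0 : ℝ) 1) : (ε / 8) ^ k * (2 * k).factorial ≤ majorant ε Λ k X := by
  have h1 : 0 < 1 - X / 2 := by linarith [hX.2]
  have h2 : 1 ≤ (1 - X / 2)⁻¹ := (one_le_inv₀ h1).2 (by linarith [hX.1])
  have h3 : (1 : ℝ) ≤ Real.exp (Λ * X) * (1 - X / 2)⁻¹ ^ (2 * k + 2) :=
    one_le_mul_of_one_le_of_one_le (Real.one_le_exp (mul_nonneg hΛ hX.1)) (one_le_pow₀ h2)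
  have h4 : ((2 * k).factorial : ℝ) ≤ (2 * k + 1).factorial := by
    exact_mod_cast Nat.factorial_le (Nat.le_succ _)
  unfold majorant
  refine le_trans ?_ (le_mul_of_one_le_right (by positivity) h3)
  gcongr

/-- Bound for the hierarchy `pₖ'' = Λ² pₖ - pₖ₊₁ / ε` with Cauchy data at `X = 0`. -/
lemma abs_hierarchy_le {ε Λ A B : ℝ} (hε : 0 < ε) (hε2 : ε ≤ 1 / 2) (hΛ : 1 / (2 * ε) ≤ Λ)
    (hA : 0 ≤ A) (hB0 : 0 ≤ B) (p p' : ℕ → ℝ → ℝ)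
    (hp : ∀ k, ∀ X ∈ Icc (0 : ℝ) 1, HasDerivAt (p k) (p' k X) X)
    (hp' : ∀ k, ∀ X ∈ Icc (0 : ℝ) 1,
      HasDerivAt (p' k) (Λ ^ 2 * p k X - p (k + 1) X / ε) X)
    (h0 : ∀ k, |p k 0| ≤ A * ((ε / 8) ^ k * (2 * k).factorial))
    (h0' : ∀ k, |p' k 0| ≤ A * ((ε / 8) ^ (k + 1) * (2 * (k + 1)).factorial)
      + A * ((ε / 8) ^ k * (2 * k).factorial) / (2 * ε))
    (hB : ∀ k, ∀ X ∈ Icc (0 : ℝ) 1, |p k X| ≤ B * ((ε / 8) ^ k * (2 * k).factorial)) :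
    ∀ X ∈ Icc (0 : ℝ) 1, |p 0 X| ≤ 8 * A * Real.exp Λ := by
  have hΛ0 : 0 ≤ Λ := le_trans (by positivity) hΛ
  have hz : (0 : ℝ) ∈ Icc (0 : ℝ) 1 := ⟨le_rfl, zero_le_one⟩
  have hW0' : ∀ k, (ε / 8) ^ (k + 1) * (2 * (k + 1)).factorial
      + ((ε / 8) ^ k * (2 * k).factorial) / (2 * ε) ≤ majorantDeriv ε Λ k 0 := by
    intro k
    have h1 : ((2 * (k + 1)).factorial : ℝ) = (2 * k + 2) * (2 * k + 1).factorial := by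
      rw [show 2 * (k + 1) = (2 * k + 1) + 1 by ring, Nat.factorial_succ]
      push_cast
      ring
    have h2 : ((2 * k).factorial : ℝ) ≤ (2 * k + 1).factorial := by
      exact_mod_cast Nat.factorial_le (Nat.le_succ _)
    have h3 : majorantDeriv ε Λ k 0
        = (ε / 8) ^ k * (2 * k + 1).factorial * Λ
          + (ε / 8) ^ k * (2 * k + 1).factorial * (k + 1) := by
      unfold majorantDeriv
      simp
      ring
    have h4 : (ε / 8) ^ k * (2 * k).factorial / (2 * ε)
        ≤ (ε / 8) ^ k * (2 * k + 1).factorial * Λ := by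
      rw [div_eq_mul_one_div]
      gcongr
    have h5 : (ε / 8) ^ (k + 1) * (2 * (k + 1)).factorial
        ≤ (ε / 8) ^ k * (2 * k + 1).factorial * (k + 1) := by
      rw [h1, pow_succ]
      have : 0 ≤ (ε / 8) ^ k * (2 * k + 1).factorial * ((k : ℝ) + 1) := by positivity
      nlinarith
    linarith
  have step : ∀ n : ℕ, ∀ k, ∀ X ∈ Icc (0 : ℝ) 1,
      |p k X| ≤ (2 * A + B / 2 ^ n) * majorant ε Λ k X := by
    intro n
    induction n with
    | zero =>
      intro k X hX
      have h1 := factorial_le_majorant hε hΛ0 k hX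
      have h2 := mul_le_mul_of_nonneg_left h1 hB0
      have h3 := mul_nonneg hA (majorant_pos hε Λ k hX).le
      rw [pow_zero, div_one]
      linarith [hB k X hX]
    | succ n ih =>
      intro k
      have key : ∀ c : ℝ, |c| = 1 → ∀ X ∈ Icc (0 : ℝ) 1,
          0 ≤ (2 * A + B / 2 ^ (n + 1)) * majorant ε Λ k X + c * p k X := by
        intro c hc
        have hL : A ≤ 2 * A + B / 2 ^ (n + 1) := by
          have : 0 ≤ B / 2 ^ (n + 1) := by positivity
          linarith
        refine nonneg_of_second_deriv_ge hΛ0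
          (fun X hX => ((hasDerivAt_majorant ε Λ k hX).const_mul _).add ((hp k X hX).const_mul c))
          (fun X hX => ((hasDerivAt_majorantDeriv ε Λ k hX).const_mul _).add
            ((hp' k X hX).const_mul c)) ?_ ?_ ?_
        · intro X hX
          have h1 := mul_le_mul_of_nonneg_left (le_majorantDeriv₂ hε hΛ0 k hX) (hA.trans hL)
          have h2 : c * p (k + 1) X ≤ (2 * A + B / 2 ^ n) * majorant ε Λ (k + 1) X := by
            refine (le_abs_self _).trans ?_
            rw [abs_mul, hc, one_mul]
            exact ih (k + 1) X hX
          have h3 : (2 * A + B / 2 ^ n) * majorant ε Λ (k + 1) X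
              ≤ (2 * A + B / 2 ^ (n + 1)) * (2 * majorant ε Λ (k + 1) X) := by
            have : B / 2 ^ n = 2 * (B / 2 ^ (n + 1)) := by rw [pow_succ]; field_simp
            rw [this]
            have := mul_nonneg hA (majorant_pos hε Λ (k + 1) hX).le
            nlinarith
          have h4 : c * p (k + 1) X / ε
              ≤ (2 * A + B / 2 ^ (n + 1)) * (2 / ε * majorant ε Λ (k + 1) X) := by
            rw [div_le_iff₀ hε]
            refine (h2.trans h3).trans_eq ?_
            field_simp
          have h5 : c * (p (k + 1) X / ε) = c * p (k + 1) X / ε := by ring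
          rw [mul_sub, h5]
          nlinarith
        · have h1 := factorial_le_majorant hε hΛ0 k hz
          have h2 : -(c * p k 0) ≤ A * ((ε / 8) ^ k * (2 * k).factorial) := by
            refine (neg_le_abs _).trans ?_
            rw [abs_mul, hc, one_mul]
            exact h0 k
          have h3 := mul_le_mul hL h1 (by positivity) (hA.trans hL)
          linarith
        · have h2 : -(c * p' k 0) ≤ A * ((ε / 8) ^ (k + 1) * (2 * (k + 1)).factorial)
              + A * ((ε / 8) ^ k * (2 * k).factorial) / (2 * ε) := by
            refine (neg_le_abs _).trans ?_
            rw [abs_mul, hc, one_mul]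
            exact h0' k
          have h3 := mul_le_mul hL (hW0' k) (by positivity) (hA.trans hL)
          rw [mul_add, ← mul_div_assoc] at h3
          linarith
      intro X hX
      have h1 := key 1 (by simp) X hX
      have h2 := key (-1) (by simp) X hX
      exact abs_le.2 ⟨by linarith, by linarith⟩
  intro X hX
  have hlim : Filter.Tendsto (fun n : ℕ => (2 * A + B / 2 ^ n) * majorant ε Λ 0 X) Filter.atTop
      (nhds ((2 * A + 0) * majorant ε Λ 0 X)) := by
    refine (Filter.Tendsto.const_add _ ?_).mul_const _
    have := (tendsto_pow_atTop_nhds_zero_of_lt_one (r := (1 / 2 : ℝ)) (by norm_num)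
      (by norm_num)).const_mul B
    simpa [div_eq_mul_inv] using this
  have h1 := ge_of_tendsto' hlim fun n => step n 0 X hX
  refine h1.trans ?_
  have h2 : majorant ε Λ 0 X ≤ Real.exp Λ * 4 := by
    have h3 : 0 < 1 - X / 2 := by linarith [hX.2]
    have h4 : (1 - X / 2)⁻¹ ≤ 2 := by
      rw [inv_le_comm₀ h3 two_pos]
      linarith [hX.2]
    unfold majorant
    simp only [pow_zero, mul_zero, zero_add, Nat.factorial_one, Nat.cast_one, one_mul]
    refine mul_le_mul (Real.exp_le_exp.2 (mul_le_of_le_one_right hΛ0 hX.2)) ?_ (by positivity)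
      (by positivity)
    calc (1 - X / 2)⁻¹ ^ 2 ≤ 2 ^ 2 := by gcongr
      _ = 4 := by norm_num
  calc _ ≤ (2 * A + 0) * (Real.exp Λ * 4) := by gcongr
    _ = _ := by ring

/-! ### Symmetrised solutions and their energy -/

lemma hasDerivAt_intervalIntegral_of_continuous {F F' : ℝ → ℝ → ℝ} (a b : ℝ)
    (hF : ∀ s, Continuous (F s)) (hF' : Continuous fun p : ℝ × ℝ => F' p.1 p.2)
    (h : ∀ s X, HasDerivAt (fun s => F s X) (F' s X) s) (s : ℝ) :
    HasDerivAt (fun s => ∫ X in a..b, F s X) (∫ X in a..b, F' s X) s := by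
  obtain ⟨C, hC⟩ := ((isCompact_Icc (a := s - 1) (b := s + 1)).prod
    (isCompact_uIcc (a := a) (b := b))).exists_bound_of_continuousOn hF'.continuousOn
  refine (intervalIntegral.hasDerivAt_integral_of_dominated_loc_of_deriv_le
    (s := Icc (s - 1) (s + 1)) (bound := fun _ => C) (Icc_mem_nhds (by linarith) (by linarith))
    (Filter.Eventually.of_forall fun t => (hF t).aestronglyMeasurable)
    ((hF s).intervalIntegrable _ _)
    (hF'.comp (continuous_const.prodMk continuous_id)).aestronglyMeasurable
    (Filter.Eventually.of_forall fun X hX t ht => hC (t, X) ⟨ht, uIoc_subset_uIcc hX⟩)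
    intervalIntegrable_const
    (Filter.Eventually.of_forall fun X _ t _ => h t X)).2

/-- `H k` is the `k`-th time derivative of a solution of `η_s = ε (η_XX - Λ² η)` on
`[0,T] × [0,1]` with `η_s = ±η_X - η / (2ε)` at `X = 0` and `X = 1`; `Hx k` and `Hxx k` are its
space derivatives. -/
structure SymSol (T ε Λ : ℝ) (H Hx Hxx : ℕ → ℝ → ℝ → ℝ) : Prop where
  cont : ∀ k, Continuous fun p : ℝ × ℝ => H k p.1 p.2
  contx : ∀ k, Continuous fun p : ℝ × ℝ => Hx k p.1 p.2
  contxx : ∀ k, Continuous fun p : ℝ × ℝ => Hxx k p.1 p.2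
  hasDerivAt_time : ∀ k s X, HasDerivAt (fun s => H k s X) (H (k + 1) s X) s
  hasDerivAt_space : ∀ k s X, HasDerivAt (H k s) (Hx k s X) X
  hasDerivAt_spacex : ∀ k s X, HasDerivAt (Hx k s) (Hxx k s X) X
  eqn : ∀ k, ∀ s ∈ Icc 0 T, ∀ X ∈ Icc (0 : ℝ) 1,
    H (k + 1) s X = ε * (Hxx k s X - Λ ^ 2 * H k s X)
  left : ∀ k, ∀ s ∈ Icc 0 T, H (k + 1) s 0 = Hx k s 0 - H k s 0 / (2 * ε)
  right : ∀ k, ∀ s ∈ Icc 0 T, H (k + 1) s 1 = -Hx k s 1 - H k s 1 / (2 * ε)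

/-- The inner product `∫ f g + ε (f(0) g(0) + f(1) g(1))`. -/
def pairing (ε : ℝ) (f g : ℝ → ℝ) : ℝ :=
  (∫ X in (0 : ℝ)..1, f X * g X) + ε * (f 0 * g 0 + f 1 * g 1)

/-- The Dirichlet form of the symmetrised operator. -/
def dirichletForm (ε Λ : ℝ) (f f' g g' : ℝ → ℝ) : ℝ :=
  ε * (∫ X in (0 : ℝ)..1, f' X * g' X) + ε * Λ ^ 2 * (∫ X in (0 : ℝ)..1, f X * g X)
    + (f 0 * g 0 + f 1 * g 1) / 2

lemma dirichletForm_comm (ε Λ : ℝ) (f f' g g' : ℝ → ℝ) :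
    dirichletForm ε Λ f f' g g' = dirichletForm ε Λ g g' f f' := by
  simp only [dirichletForm, mul_comm]

lemma pairing_comm (ε : ℝ) (f g : ℝ → ℝ) : pairing ε f g = pairing ε g f := by
  simp only [pairing, mul_comm]

lemma pairing_self_nonneg {ε : ℝ} (hε : 0 ≤ ε) (f : ℝ → ℝ) : 0 ≤ pairing ε f f := by
  have : 0 ≤ ∫ X in (0 : ℝ)..1, f X * f X :=
    intervalIntegral.integral_nonneg zero_le_one fun _ _ => mul_self_nonneg _
  have := mul_self_nonneg (f 0)
  have := mul_self_nonneg (f 1)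
  unfold pairing
  positivity

lemma sq_le_dirichletForm {ε Λ : ℝ} (hε : 0 < ε) (hε2 : ε ≤ 1 / 2) {f f' : ℝ → ℝ}
    (hf : ∀ X, HasDerivAt f (f' X) X) (hf' : Continuous f') {X : ℝ} (hX : X ∈ Icc (0 : ℝ) 1) :
    f X ^ 2 ≤ 4 / ε * dirichletForm ε Λ f f' f f' := by
  have hfc : Continuous f := continuous_iff_continuousAt.2 fun X => (hf X).continuousAt
  have hI : ∀ a b, IntervalIntegrable f' volume a b := fun a b => hf'.intervalIntegrable a b
  have hI2 : ∀ a b, IntervalIntegrable (fun Y => f' Y * f' Y) volume a b :=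
    fun a b => (hf'.mul hf').intervalIntegrable a b
  set K := ∫ Y in (0 : ℝ)..1, f' Y * f' Y with hK
  have h1 : f X - f 0 = ∫ Y in (0 : ℝ)..X, f' Y :=
    (intervalIntegral.integral_eq_sub_of_hasDerivAt (fun Y _ => hf Y) (hI _ _)).symm
  have h2 : ∀ c : ℝ, 0 ≤ K - 2 * c * (f X - f 0) + c ^ 2 := by
    intro c
    have h3 : ∫ Y in (0 : ℝ)..X, (f' Y - c) ^ 2
        = (∫ Y in (0 : ℝ)..X, f' Y * f' Y) - 2 * c * (f X - f 0) + c ^ 2 * X := by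
      rw [h1, ← intervalIntegral.integral_const_mul, ← intervalIntegral.integral_sub (hI2 _ _)
        ((hI _ _).const_mul _)]
      have : c ^ 2 * X = ∫ Y in (0 : ℝ)..X, c ^ 2 := by simp; ring
      rw [this, ← intervalIntegral.integral_add ((hI2 _ _).sub ((hI _ _).const_mul _)) (by simp)]
      congr 1
      ext Y
      ring
    have h4 : 0 ≤ ∫ Y in (0 : ℝ)..X, (f' Y - c) ^ 2 :=
      intervalIntegral.integral_nonneg hX.1 fun _ _ => sq_nonneg _
    have h5 : ∫ Y in (0 : ℝ)..X, f' Y * f' Y ≤ K :=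
      intervalIntegral.integral_mono_interval le_rfl hX.1 hX.2
        (Filter.Eventually.of_forall fun Y => mul_self_nonneg _) (hI2 _ _)
    nlinarith [sq_nonneg c, hX.2]
  have h3 := h2 (f X - f 0)
  have h4 : f X ^ 2 ≤ 2 * f 0 ^ 2 + 2 * K := by nlinarith [sq_nonneg (f X - 2 * f 0)]
  have h5 : 0 ≤ ∫ X in (0 : ℝ)..1, f X * f X :=
    intervalIntegral.integral_nonneg zero_le_one fun _ _ => mul_self_nonneg _
  have h6 : 0 ≤ ε * Λ ^ 2 * ∫ X in (0 : ℝ)..1, f X * f X := by positivity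
  have hK0 : 0 ≤ K := intervalIntegral.integral_nonneg zero_le_one fun _ _ => mul_self_nonneg _
  refine h4.trans ?_
  rw [div_mul_eq_mul_div, le_div_iff₀ hε]
  unfold dirichletForm
  rw [← hK]
  nlinarith [mul_self_nonneg (f 0), mul_self_nonneg (f 1), mul_nonneg hε.le hK0]

/-- Coercivity of the Dirichlet form with respect to the energy. -/
lemma mul_pairing_le_dirichletForm {ε Λ : ℝ} (hε : 0 < ε) (hε2 : ε ≤ 1 / 2)
    (hΛ : 1 / (2 * ε) ≤ Λ) {f f' : ℝ → ℝ} (hf : ∀ X, HasDerivAt f (f' X) X)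
    (hf' : Continuous f') :
    Λ * pairing ε f f ≤ 7 * dirichletForm ε Λ f f' f f' := by
  have hfc : Continuous f := continuous_iff_continuousAt.2 fun X => (hf X).continuousAt
  have hΛε : 1 ≤ 2 * (ε * Λ) := by
    rw [div_le_iff₀ (by positivity)] at hΛ
    linarith
  have hΛ1 : 1 ≤ Λ := by nlinarith
  set S := ∫ X in (0 : ℝ)..1, f X * f X with hS
  set K := ∫ X in (0 : ℝ)..1, f' X * f' X with hK
  have hS0 : 0 ≤ S := intervalIntegral.integral_nonneg zero_le_one fun _ _ => mul_self_nonneg _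
  have hK0 : 0 ≤ K := intervalIntegral.integral_nonneg zero_le_one fun _ _ => mul_self_nonneg _
  have h1 : f 0 * f 0 + f 1 * f 1
      = ∫ X in (0 : ℝ)..1, (2 * (f X * f X) + (2 * X - 1) * (2 * (f X * f' X))) := by
    have := intervalIntegral.integral_eq_sub_of_hasDerivAt (a := 0) (b := 1)
      (f := fun X => (2 * X - 1) * (f X * f X))
      (f' := fun X => 2 * (f X * f X) + (2 * X - 1) * (2 * (f X * f' X)))
      (fun X _ => by
        refine ((((hasDerivAt_id X).const_mul 2).sub_const 1).mul
          ((hf X).mul (hf X))).congr_deriv ?_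
        simp only [id, Pi.mul_apply]
        ring)
      (Continuous.intervalIntegrable (by fun_prop) _ _)
    rw [this]
    ring
  have h2 : f 0 * f 0 + f 1 * f 1 ≤ 2 * S + (1 / Λ * K + Λ * S) := by
    rw [h1, hS, hK, ← intervalIntegral.integral_const_mul, ← intervalIntegral.integral_const_mul,
      ← intervalIntegral.integral_const_mul, ← intervalIntegral.integral_add
        (Continuous.intervalIntegrable (by fun_prop) _ _)
        (Continuous.intervalIntegrable (by fun_prop) _ _), ← intervalIntegral.integral_add
        (Continuous.intervalIntegrable (by fun_prop) _ _)
        (Continuous.intervalIntegrable (by fun_prop) _ _)]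
    refine intervalIntegral.integral_mono_on zero_le_one
      (Continuous.intervalIntegrable (by fun_prop) _ _)
      (Continuous.intervalIntegrable (by fun_prop) _ _) fun X hX => ?_
    have h3 : (2 * X - 1) * (2 * (f X * f' X)) ≤ |2 * (f X * f' X)| := by
      refine (le_abs_self _).trans ?_
      rw [abs_mul]
      exact mul_le_of_le_one_left (abs_nonneg _) (abs_le.2 ⟨by linarith [hX.1], by linarith [hX.2]⟩)
    have h4 : |2 * (f X * f' X)| ≤ 1 / Λ * (f' X * f' X) + Λ * (f X * f X) := by
      have hΛ0 : 0 < Λ := by linarith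
      have e1 : 1 / Λ * (f' X * f' X) + Λ * (f X * f X) - 2 * (f X * f' X)
          = 1 / Λ * (f' X - Λ * f X) ^ 2 := by field_simp; ring
      have e2 : 1 / Λ * (f' X * f' X) + Λ * (f X * f X) + 2 * (f X * f' X)
          = 1 / Λ * (f' X + Λ * f X) ^ 2 := by field_simp; ring
      have i1 : 0 ≤ 1 / Λ * (f' X - Λ * f X) ^ 2 := by positivity
      have i2 : 0 ≤ 1 / Λ * (f' X + Λ * f X) ^ 2 := by positivity
      exact abs_le.2 ⟨by linarith, by linarith⟩
    linarith
  have h3 : Λ * (f 0 * f 0 + f 1 * f 1) ≤ 2 * Λ * S + K + Λ ^ 2 * S := by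
    have := mul_le_mul_of_nonneg_left h2 (by linarith : 0 ≤ Λ)
    refine this.trans_eq ?_
    field_simp
    ring
  have h4 := mul_le_mul_of_nonneg_left h3 hε.le
  have h5 : Λ * S ≤ 2 * (ε * Λ ^ 2 * S) := by
    have := mul_le_mul_of_nonneg_right hΛε (by positivity : 0 ≤ Λ * S)
    linarith
  have h6 : ε * (Λ * S) ≤ ε * Λ ^ 2 * S := by
    have := mul_le_mul_of_nonneg_right hΛ1 (by positivity : 0 ≤ ε * (Λ * S))
    linarith
  unfold pairing dirichletForm
  rw [← hS, ← hK]
  nlinarith [mul_self_nonneg (f 0), mul_self_nonneg (f 1), mul_nonneg hε.le hK0]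

namespace SymSol

variable {T ε Λ : ℝ} {H Hx Hxx : ℕ → ℝ → ℝ → ℝ}

lemma continuous_slice (h : SymSol T ε Λ H Hx Hxx) (k : ℕ) (s : ℝ) : Continuous (H k s) :=
  (h.cont k).comp (continuous_const.prodMk continuous_id)

lemma continuous_slicex (h : SymSol T ε Λ H Hx Hxx) (k : ℕ) (s : ℝ) : Continuous (Hx k s) :=
  (h.contx k).comp (continuous_const.prodMk continuous_id)

lemma continuous_slicexx (h : SymSol T ε Λ H Hx Hxx) (k : ℕ) (s : ℝ) : Continuous (Hxx k s) :=
  (h.contxx k).comp (continuous_const.prodMk continuous_id)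

lemma pairing_succ (h : SymSol T ε Λ H Hx Hxx) (hε : 0 < ε) (j i : ℕ) {s : ℝ} (hs : s ∈ Icc 0 T)
    (t : ℝ) :
    pairing ε (H (j + 1) s) (H i t)
      = -dirichletForm ε Λ (H j s) (Hx j s) (H i t) (Hx i t) := by
  have c1 := h.continuous_slice j s
  have c2 := h.continuous_slice i t
  have c3 := h.continuous_slicexx j s
  have c4 := h.continuous_slicex j s
  have c5 := h.continuous_slicex i t
  have h1 : ∫ X in (0 : ℝ)..1, H (j + 1) s X * H i t X
      = ε * (∫ X in (0 : ℝ)..1, H i t X * Hxx j s X)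
        - ε * Λ ^ 2 * (∫ X in (0 : ℝ)..1, H j s X * H i t X) := by
    rw [← intervalIntegral.integral_const_mul, ← intervalIntegral.integral_const_mul,
      ← intervalIntegral.integral_sub (Continuous.intervalIntegrable (by fun_prop) _ _)
        (Continuous.intervalIntegrable (by fun_prop) _ _)]
    refine intervalIntegral.integral_congr fun X hX => ?_
    rw [uIcc_of_le zero_le_one] at hX
    rw [h.eqn j s hs X hX]
    ring
  have h2 := intervalIntegral.integral_mul_deriv_eq_deriv_mul (a := 0) (b := 1)
    (fun X _ => h.hasDerivAt_space i t X) (fun X _ => h.hasDerivAt_spacex j s X)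
    (c5.intervalIntegrable _ _) (c3.intervalIntegrable _ _)
  have h3 : ∫ X in (0 : ℝ)..1, Hx i t X * Hx j s X = ∫ X in (0 : ℝ)..1, Hx j s X * Hx i t X := by
    simp only [mul_comm]
  unfold pairing dirichletForm
  rw [h1, h2, h3, h.left j s hs, h.right j s hs]
  field_simp
  ring

lemma hasDerivAt_pairing (h : SymSol T ε Λ H Hx Hxx) (i j : ℕ) {a b : ℝ → ℝ} {a' b' : ℝ}
    (hac : Continuous a) (hbc : Continuous b)
    (ha : ∀ s, HasDerivAt a a' s) (hb : ∀ s, HasDerivAt b b' s) (s : ℝ) :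
    HasDerivAt (fun s => pairing ε (H i (a s)) (H j (b s)))
      (a' * pairing ε (H (i + 1) (a s)) (H j (b s))
        + b' * pairing ε (H i (a s)) (H (j + 1) (b s))) s := by
  have c : ∀ (k : ℕ) (w : ℝ → ℝ), Continuous w → Continuous fun p : ℝ × ℝ => H k (w p.1) p.2 :=
    fun k w hw => (h.cont k).comp ((hw.comp continuous_fst).prodMk continuous_snd)
  have d : ∀ X s, HasDerivAt (fun s => H i (a s) X * H j (b s) X)
      (a' * (H (i + 1) (a s) X * H j (b s) X) + b' * (H i (a s) X * H (j + 1) (b s) X)) s := by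
    intro X s
    refine (((h.hasDerivAt_time i (a s) X).comp s (ha s)).mul
      ((h.hasDerivAt_time j (b s) X).comp s (hb s))).congr_deriv ?_
    simp only [Function.comp]
    ring
  have h1 := hasDerivAt_intervalIntegral_of_continuous (F := fun s X => H i (a s) X * H j (b s) X)
    (F' := fun s X =>
      a' * (H (i + 1) (a s) X * H j (b s) X) + b' * (H i (a s) X * H (j + 1) (b s) X)) 0 1
    (fun s => (h.continuous_slice i _).mul (h.continuous_slice j _))
    ((continuous_const.mul ((c _ _ hac).mul (c _ _ hbc))).add
      (continuous_const.mul ((c _ _ hac).mul (c _ _ hbc)))) (fun s X => d X s) s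
  refine (h1.add (((d 0 s).add (d 1 s)).const_mul ε)).congr_deriv ?_
  rw [intervalIntegral.integral_add, intervalIntegral.integral_const_mul,
    intervalIntegral.integral_const_mul]
  · unfold pairing
    ring
  · exact (continuous_const.mul ((h.continuous_slice _ _).mul
      (h.continuous_slice _ _))).intervalIntegrable _ _
  · exact (continuous_const.mul ((h.continuous_slice _ _).mul
      (h.continuous_slice _ _))).intervalIntegrable _ _

/-- Energy of the `k`-th time derivative. -/
lemma hasDerivAt_energy (h : SymSol T ε Λ H Hx Hxx) (hε : 0 < ε) (k : ℕ) {s : ℝ}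
    (hs : s ∈ Icc 0 T) :
    HasDerivAt (fun s => pairing ε (H k s) (H k s))
      (-2 * dirichletForm ε Λ (H k s) (Hx k s) (H k s) (Hx k s)) s := by
  refine (h.hasDerivAt_pairing k k continuous_id continuous_id hasDerivAt_id
    hasDerivAt_id s).congr_deriv ?_
  simp only [id]
  rw [pairing_comm ε (H k s), h.pairing_succ hε k k hs]
  ring

lemma antitoneOn_energy (h : SymSol T ε Λ H Hx Hxx) (hε : 0 < ε) (hε2 : ε ≤ 1 / 2)
    (k : ℕ) : AntitoneOn (fun s => pairing ε (H k s) (H k s)) (Icc 0 T) := by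
  refine antitoneOn_of_deriv_nonpos (convex_Icc _ _)
    (fun s hs => (h.hasDerivAt_energy hε k hs).continuousAt.continuousWithinAt)
    (fun s hs => (h.hasDerivAt_energy hε k
      (interior_subset hs)).differentiableAt.differentiableWithinAt) fun s hs => ?_
  rw [(h.hasDerivAt_energy hε k (interior_subset hs)).deriv]
  have h1 := sq_le_dirichletForm (Λ := Λ) hε hε2 (h.hasDerivAt_space k s) (h.continuous_slicex k s)
    (X := 0) ⟨le_rfl, zero_le_one⟩
  have h2 := nonneg_of_mul_nonneg_right ((sq_nonneg _).trans h1) (by positivity)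
  linarith

lemma antitoneOn_dirichletForm (h : SymSol T ε Λ H Hx Hxx) (hε : 0 < ε) (k : ℕ) :
    AntitoneOn (fun s => dirichletForm ε Λ (H k s) (Hx k s) (H k s) (Hx k s)) (Icc 0 T) := by
  have e : ∀ s ∈ Icc 0 T, dirichletForm ε Λ (H k s) (Hx k s) (H k s) (Hx k s)
      = -pairing ε (H (k + 1) s) (H k s) := fun s hs => by
    rw [h.pairing_succ hε k k hs, neg_neg]
  refine AntitoneOn.congr ?_ fun s hs => (e s hs).symm
  have d := fun s => (h.hasDerivAt_pairing (k + 1) k continuous_id continuous_id hasDerivAt_id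
    hasDerivAt_id s).neg
  refine antitoneOn_of_deriv_nonpos (convex_Icc _ _)
    (fun s _ => (d s).continuousAt.continuousWithinAt)
    (fun s _ => (d s).differentiableAt.differentiableWithinAt) fun s hs => ?_
  have hs := interior_subset hs
  refine (d s).deriv.trans_le ?_
  simp only [id]
  rw [h.pairing_succ hε (k + 1) k hs, dirichletForm_comm, ← h.pairing_succ hε k (k + 1) hs]
  linarith [pairing_self_nonneg hε.le (H (k + 1) s)]

end SymSol

/-! ### Dissipation, smoothing and the observability estimate -/

lemma mul_le_of_deriv_antitone {f g : ℝ → ℝ} {a b : ℝ} (hab : a ≤ b)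
    (hf : ∀ s ∈ Icc a b, HasDerivAt f (-2 * g s) s) (hg : AntitoneOn g (Icc a b))
    (hb : 0 ≤ f b) : 2 * (b - a) * g b ≤ f a := by
  rcases hab.eq_or_lt with rfl | hab
  · simpa using hb
  obtain ⟨c, hc, hc'⟩ := exists_hasDerivAt_eq_slope f (fun s => -2 * g s) hab
    (fun s hs => (hf s hs).continuousAt.continuousWithinAt)
    (fun s hs => hf s (Ioo_subset_Icc_self hs))
  rw [eq_div_iff (by linarith)] at hc'
  have := hg (Ioo_subset_Icc_self hc) (right_mem_Icc.2 hab.le) hc.2.le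
  nlinarith

lemma exp_decay_of_deriv_le {f f' : ℝ → ℝ} {c a b : ℝ} (hab : a ≤ b)
    (hf : ∀ s ∈ Icc a b, HasDerivAt f (f' s) s) (h : ∀ s ∈ Icc a b, f' s ≤ -c * f s) :
    f b ≤ Real.exp (-c * (b - a)) * f a := by
  have hd : ∀ s ∈ Icc a b, HasDerivAt (fun s => Real.exp (c * s) * f s)
      (Real.exp (c * s) * (c * f s + f' s)) s := by
    intro s hs
    refine ((hasDerivAt_exp_mul c s).mul (hf s hs)).congr_deriv ?_
    ring
  have hm : AntitoneOn (fun s => Real.exp (c * s) * f s) (Icc a b) := by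
    refine antitoneOn_of_deriv_nonpos (convex_Icc _ _)
      (fun s hs => (hd s hs).continuousAt.continuousWithinAt)
      (fun s hs => (hd s (interior_subset hs)).differentiableAt.differentiableWithinAt)
      fun s hs => ?_
    rw [(hd s (interior_subset hs)).deriv]
    exact mul_nonpos_of_nonneg_of_nonpos (Real.exp_pos _).le
      (by linarith [h s (interior_subset hs)])
  have h1 := hm (left_mem_Icc.2 hab) (right_mem_Icc.2 hab) hab
  have h2 := mul_le_mul_of_nonneg_left h1 (Real.exp_pos (-c * b)).le
  simp only [← mul_assoc, ← Real.exp_add] at h2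
  have e1 : -c * b + c * b = 0 := by ring
  have e2 : -c * b + c * a = -c * (b - a) := by ring
  rwa [e1, e2, Real.exp_zero, one_mul] at h2

namespace SymSol

variable {T ε Λ : ℝ} {H Hx Hxx : ℕ → ℝ → ℝ → ℝ}

lemma energy_decay (h : SymSol T ε Λ H Hx Hxx) (hε : 0 < ε) (hε2 : ε ≤ 1 / 2)
    (hΛ : 1 / (2 * ε) ≤ Λ) {a : ℝ} (ha : 0 ≤ a) (haT : a ≤ T) :
    pairing ε (H 0 T) (H 0 T)
      ≤ Real.exp (-(2 * Λ / 7) * (T - a)) * pairing ε (H 0 a) (H 0 a) := by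
  have hsub : Icc a T ⊆ Icc 0 T := Icc_subset_Icc ha le_rfl
  refine exp_decay_of_deriv_le haT (fun s hs => h.hasDerivAt_energy hε 0 (hsub hs)) fun s hs => ?_
  have := mul_pairing_le_dirichletForm hε hε2 hΛ (h.hasDerivAt_space 0 s) (h.continuous_slicex 0 s)
  linarith

lemma dirichletForm_le_energy (h : SymSol T ε Λ H Hx Hxx) (hε : 0 < ε) (k : ℕ) {a b : ℝ}
    (ha : 0 ≤ a) (hab : a ≤ b) (hb : b ≤ T) :
    2 * (b - a) * dirichletForm ε Λ (H k b) (Hx k b) (H k b) (Hx k b)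
      ≤ pairing ε (H k a) (H k a) :=
  mul_le_of_deriv_antitone hab
    (fun _ hs => h.hasDerivAt_energy hε k (Icc_subset_Icc ha hb hs))
    ((h.antitoneOn_dirichletForm hε k).mono (Icc_subset_Icc ha hb)) (pairing_self_nonneg hε.le _)

lemma energy_succ_le_dirichletForm (h : SymSol T ε Λ H Hx Hxx) (hε : 0 < ε) (hε2 : ε ≤ 1 / 2)
    (k : ℕ) {a b : ℝ} (ha : 0 ≤ a) (hab : a ≤ b) (hb : b ≤ T) :
    2 * (b - a) * pairing ε (H (k + 1) b) (H (k + 1) b)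
      ≤ dirichletForm ε Λ (H k a) (Hx k a) (H k a) (Hx k a) := by
  have haT : a ∈ Icc 0 T := ⟨ha, hab.trans hb⟩
  have hbT : b ∈ Icc 0 T := ⟨ha.trans hab, hb⟩
  have e : ∀ s ∈ Icc 0 T, -pairing ε (H (k + 1) s) (H k s)
      = dirichletForm ε Λ (H k s) (Hx k s) (H k s) (Hx k s) := fun s hs => by
    rw [h.pairing_succ hε k k hs, neg_neg]
  rw [← e a haT]
  refine mul_le_of_deriv_antitone (f := fun s => -pairing ε (H (k + 1) s) (H k s))
    (g := fun s => pairing ε (H (k + 1) s) (H (k + 1) s)) hab (fun s hs => ?_)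
    ((h.antitoneOn_energy hε hε2 (k + 1)).mono (Icc_subset_Icc ha hb)) ?_
  · have hs := Icc_subset_Icc ha hb hs
    refine (h.hasDerivAt_pairing (k + 1) k continuous_id continuous_id hasDerivAt_id
      hasDerivAt_id s).neg.congr_deriv ?_
    simp only [id]
    rw [h.pairing_succ hε (k + 1) k hs, dirichletForm_comm, ← h.pairing_succ hε k (k + 1) hs]
    ring
  · have h1 := sq_le_dirichletForm (Λ := Λ) hε hε2 (h.hasDerivAt_space k b)
      (h.continuous_slicex k b) (X := 0) ⟨le_rfl, zero_le_one⟩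
    rw [e b hbT]
    exact nonneg_of_mul_nonneg_right ((sq_nonneg _).trans h1) (by positivity)

lemma energy_le_pow_mul (h : SymSol T ε Λ H Hx Hxx) (hε : 0 < ε) (hε2 : ε ≤ 1 / 2) (k : ℕ) {a : ℝ}
    (ha : 0 ≤ a) (haT : a + 1 ≤ T) :
    pairing ε (H k (a + 1)) (H k (a + 1)) ≤ ((k : ℝ) ^ k) ^ 2 * pairing ε (H 0 a) (H 0 a) := by
  rcases Nat.eq_zero_or_pos k with rfl | hk
  · simpa using h.antitoneOn_energy hε hε2 0 ⟨ha, by linarith⟩ ⟨by linarith, haT⟩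
      (by linarith : a ≤ a + 1)
  have hk' : (0 : ℝ) < k := by exact_mod_cast hk
  have step : ∀ j : ℕ, j ≤ k → pairing ε (H j (a + j / k)) (H j (a + j / k))
      ≤ ((k : ℝ) ^ j) ^ 2 * pairing ε (H 0 a) (H 0 a) := by
    intro j
    induction j with
    | zero => intro _; simp
    | succ j ih =>
      intro hj
      have ih := ih (by omega)
      have hj' : ((j : ℝ) + 1) / k ≤ 1 := by
        rw [div_le_one hk']
        exact_mod_cast hj
      have e1 : a + ((j + 1 : ℕ) : ℝ) / k = a + j / k + 1 / (2 * k) + 1 / (2 * k) := by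
        push_cast
        field_simp
        ring
      have hp : 0 < 1 / (2 * (k : ℝ)) := by positivity
      have hq : (0 : ℝ) ≤ j / k := by positivity
      have e2 : a + ((j + 1 : ℕ) : ℝ) / k ≤ T := by
        push_cast
        linarith
      rw [e1] at e2 ⊢
      have h1 := h.dirichletForm_le_energy hε j (a := a + j / k) (b := a + j / k + 1 / (2 * k))
        (by linarith) (by linarith) (by linarith)
      have h2 := h.energy_succ_le_dirichletForm hε hε2 j (a := a + j / k + 1 / (2 * k))
        (b := a + j / k + 1 / (2 * k) + 1 / (2 * k)) (by linarith) (by linarith) e2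
      rw [show 2 * (a + (j : ℝ) / k + 1 / (2 * k) - (a + j / k)) = 1 / k by field_simp; ring] at h1
      rw [show 2 * (a + (j : ℝ) / k + 1 / (2 * k) + 1 / (2 * k) - (a + j / k + 1 / (2 * k)))
        = 1 / k by field_simp; ring] at h2
      rw [one_div, inv_mul_le_iff₀ hk'] at h1 h2
      calc _ ≤ _ := h2
        _ ≤ k * (k * pairing ε (H j (a + j / k)) (H j (a + j / k))) := by gcongr
        _ ≤ k * (k * (((k : ℝ) ^ j) ^ 2 * pairing ε (H 0 a) (H 0 a))) := by gcongr
        _ = _ := by ring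
  have := step k le_rfl
  rwa [div_self hk'.ne'] at this

lemma abs_le_pow_mul (h : SymSol T ε Λ H Hx Hxx) (hε : 0 < ε) (hε2 : ε ≤ 1 / 2) (k : ℕ) {a s X : ℝ}
    (ha : 0 ≤ a) (hs : a + 2 ≤ s) (hsT : s ≤ T) (hX : X ∈ Icc (0 : ℝ) 1) :
    |H k s X| ≤ √(2 / ε) * √(pairing ε (H 0 a) (H 0 a)) * (k : ℝ) ^ k := by
  have h1 := sq_le_dirichletForm (Λ := Λ) hε hε2 (h.hasDerivAt_space k s)
    (h.continuous_slicex k s) hX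
  have h2 := h.antitoneOn_dirichletForm hε k ⟨by linarith, by linarith⟩ ⟨by linarith, hsT⟩ hs
  have h3 := h.dirichletForm_le_energy hε k (a := a + 1) (b := a + 2) (by linarith)
    (by linarith) (by linarith)
  have h4 := h.energy_le_pow_mul hε hε2 k ha (by linarith)
  have hE := pairing_self_nonneg hε.le (H 0 a)
  refine abs_le_of_sq_le_sq ?_ (by positivity)
  rw [mul_pow, mul_pow, Real.sq_sqrt (by positivity), Real.sq_sqrt hE]
  simp only at h2
  calc _ ≤ _ := h1
    _ ≤ 4 / ε * (1 / 2 * (((k : ℝ) ^ k) ^ 2 * pairing ε (H 0 a) (H 0 a))) := by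
      gcongr
      linarith
    _ = _ := by ring

lemma iteratedDeriv_time (h : SymSol T ε Λ H Hx Hxx) (k j : ℕ) (X : ℝ) :
    iteratedDeriv k (fun s => H j s X) = fun s => H (j + k) s X := by
  induction k with
  | zero => simp
  | succ k ih =>
    rw [iteratedDeriv_succ, ih]
    exact funext fun s => (h.hasDerivAt_time _ s X).deriv

lemma contDiff_time (h : SymSol T ε Λ H Hx Hxx) (j : ℕ) (X : ℝ) :
    ContDiff ℝ (⊤ : ℕ∞) fun s => H j s X := by
  refine contDiff_of_differentiable_iteratedDeriv fun m _ => ?_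
  rw [h.iteratedDeriv_time]
  exact fun s => (h.hasDerivAt_time _ s X).differentiableAt

lemma gevreyTwoOn_time (h : SymSol T ε Λ H Hx Hxx) (hε : 0 < ε) (hε2 : ε ≤ 1 / 2) {a X : ℝ}
    (ha : 0 ≤ a) (hX : X ∈ Icc (0 : ℝ) 1) :
    GevreyTwoOn (√(2 / ε) * √(pairing ε (H 0 a) (H 0 a)) * Real.exp (16 / ε)) (ε / 16)
      (fun s => H 0 s X) (Icc (a + 2) T) := by
  refine ⟨h.contDiff_time 0 X, fun k s hs => ?_⟩
  rw [h.iteratedDeriv_time, zero_add]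
  refine (h.abs_le_pow_mul hε hε2 k ha hs.1 hs.2 hX).trans ?_
  rw [mul_assoc _ (Real.exp _), mul_assoc _ (Real.exp _ * _), mul_assoc (Real.exp _)]
  refine mul_le_mul_of_nonneg_left ?_ (by positivity)
  have h1 := Real.pow_div_factorial_le_exp (16 / ε) (by positivity) k
  have h2 : (k : ℝ) ^ k * k.factorial ≤ (2 * k).factorial := by
    have h3 : k.factorial * (k + 1) ^ k ≤ (k + k).factorial := Nat.factorial_mul_pow_le_factorial
    have h4 : k ^ k ≤ (k + 1) ^ k := Nat.pow_le_pow_left (Nat.le_succ k) k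
    have : k ^ k * k.factorial ≤ (2 * k).factorial := by
      rw [two_mul, mul_comm]
      exact (Nat.mul_le_mul_left _ h4).trans h3
    exact_mod_cast this
  calc (k : ℝ) ^ k = (16 / ε) ^ k / k.factorial * ((ε / 16) ^ k * (k ^ k * k.factorial)) := by
        rw [div_pow, div_pow]
        field_simp
    _ ≤ Real.exp (16 / ε) * ((ε / 16) ^ k * (2 * k).factorial) := by gcongr

/-- Space-like propagation: a time average of the solution at any point is controlled by its
trace at `X = 0`, provided the weight is of Gevrey order two with a small constant. -/
lemma abs_integral_mul_le (h : SymSol T ε Λ H Hx Hxx) (hε : 0 < ε) (hε2 : ε ≤ 1 / 2)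
    (hΛ : 1 / (2 * ε) ≤ Λ) (hT : 1 ≤ T) {M : ℝ} (hM : 0 ≤ M) {g : ℝ → ℝ}
    (hg : GevreyTwoOn M (ε / 8) g (Icc 0 1)) (hg0 : ∀ s ∉ Ioo (0 : ℝ) 1, g s = 0) {X : ℝ}
    (hX : X ∈ Icc (0 : ℝ) 1) :
    |∫ s in (0 : ℝ)..1, g s * H 0 s X|
      ≤ 8 * (M * ∫ s in (0 : ℝ)..1, |H 0 s 0|) * Real.exp Λ := by
  set U := ∫ s in (0 : ℝ)..1, |H 0 s 0| with hU
  have hU0 : 0 ≤ U := intervalIntegral.integral_nonneg zero_le_one fun _ _ => abs_nonneg _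
  have hgc : ∀ k, Continuous (iteratedDeriv k g) := fun k =>
    hg.1.continuous_iteratedDeriv k (by exact_mod_cast le_top)
  have hgd : ∀ k s, HasDerivAt (iteratedDeriv k g) (iteratedDeriv (k + 1) g s) s := by
    intro k s
    rw [iteratedDeriv_succ]
    exact (hg.1.differentiable_iteratedDeriv k
      (by exact_mod_cast WithTop.coe_lt_top k) s).hasDerivAt
  have hsupp : tsupport g ⊆ Icc 0 1 := by
    refine closure_minimal (fun s hs => ?_) isClosed_Icc
    by_contra hs'
    exact hs (hg0 s fun hs'' => hs' (Ioo_subset_Icc_self hs''))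
  have hsuppk : ∀ k, tsupport (iteratedDeriv k g) ⊆ Icc 0 1 := by
    intro k
    induction k with
    | zero => rwa [iteratedDeriv_zero]
    | succ k ih =>
      rw [iteratedDeriv_succ]
      exact tsupport_deriv_subset.trans ih
  have hoff : ∀ k s, s ∉ Icc (0 : ℝ) 1 → iteratedDeriv k g s = 0 := fun k s hs => by
    by_contra hne
    exact hs (hsuppk k (subset_tsupport _ hne))
  have hz0 : ∀ k, iteratedDeriv k g 0 = 0 := fun k => by
    have : EqOn (iteratedDeriv k g) (fun _ => 0) (closure (Iio 0)) :=
      EqOn.closure (fun s hs => hoff k s fun hs' => absurd hs'.1 (not_le.2 hs)) (hgc k)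
        continuous_const
    exact this (by rw [closure_Iio]; exact self_mem_Iic)
  have hz1 : ∀ k, iteratedDeriv k g 1 = 0 := fun k => by
    have : EqOn (iteratedDeriv k g) (fun _ => 0) (closure (Ioi 1)) :=
      EqOn.closure (fun s hs => hoff k s fun hs' => absurd hs'.2 (not_le.2 hs)) (hgc k)
        continuous_const
    exact this (by rw [closure_Ioi]; exact self_mem_Ici)
  have hslice : ∀ k X, Continuous fun s => H k s X := fun k X =>
    (h.cont k).comp (continuous_id.prodMk continuous_const)
  have hparts : ∀ k X, ∫ s in (0 : ℝ)..1, iteratedDeriv k g s * H 1 s X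
      = -∫ s in (0 : ℝ)..1, iteratedDeriv (k + 1) g s * H 0 s X := by
    intro k X
    rw [intervalIntegral.integral_mul_deriv_eq_deriv_mul (fun s _ => hgd k s)
      (fun s _ => h.hasDerivAt_time 0 s X) ((hgc _).intervalIntegrable _ _)
      ((hslice 1 X).intervalIntegrable _ _), hz0, hz1]
    ring
  have hsT : ∀ s ∈ uIcc (0 : ℝ) 1, s ∈ Icc 0 T := fun s hs => by
    rw [uIcc_of_le zero_le_one] at hs
    exact ⟨hs.1, hs.2.trans hT⟩
  have hdiff : ∀ (k : ℕ) (F F' : ℝ → ℝ → ℝ), (Continuous fun p : ℝ × ℝ => F p.1 p.2) →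
      (Continuous fun p : ℝ × ℝ => F' p.1 p.2) → (∀ s X, HasDerivAt (F s) (F' s X) X) →
      ∀ X, HasDerivAt (fun X => ∫ s in (0 : ℝ)..1, iteratedDeriv k g s * F s X)
        (∫ s in (0 : ℝ)..1, iteratedDeriv k g s * F' s X) X := by
    intro k F F' hF hF' hd X
    refine hasDerivAt_intervalIntegral_of_continuous
      (F := fun X s => iteratedDeriv k g s * F s X)
      (F' := fun X s => iteratedDeriv k g s * F' s X) 0 1 (fun X => ?_) ?_ (fun X s => ?_) X
    · exact (hgc k).mul (hF.comp (continuous_id.prodMk continuous_const))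
    · exact ((hgc k).comp continuous_snd).mul (hF'.comp (continuous_snd.prodMk continuous_fst))
    · exact (hd s X).const_mul _
  have hbound : ∀ (k : ℕ) (f : ℝ → ℝ), Continuous f →
      |∫ s in (0 : ℝ)..1, iteratedDeriv k g s * f s|
        ≤ (M * ∫ s in (0 : ℝ)..1, |f s|) * ((ε / 8) ^ k * (2 * k).factorial) := by
    intro k f hf
    refine (intervalIntegral.abs_integral_le_integral_abs zero_le_one).trans ?_
    have e : (M * ∫ s in (0 : ℝ)..1, |f s|) * ((ε / 8) ^ k * (2 * k).factorial)
        = ∫ s in (0 : ℝ)..1, (M * (ε / 8) ^ k * (2 * k).factorial) * |f s| := by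
      rw [intervalIntegral.integral_const_mul]
      ring
    rw [e]
    refine intervalIntegral.integral_mono_on zero_le_one
      (((hgc k).mul hf).abs.intervalIntegrable _ _)
      ((continuous_const.mul hf.abs).intervalIntegrable _ _) fun s hs => ?_
    rw [abs_mul]
    exact mul_le_mul_of_nonneg_right (hg.2 k s hs) (abs_nonneg _)
  obtain ⟨B, hB⟩ := ((isCompact_Icc (a := (0 : ℝ)) (b := 1)).prod
    (isCompact_Icc (a := (0 : ℝ)) (b := 1))).exists_bound_of_continuousOn (h.cont 0).continuousOn
  have hB0 : 0 ≤ B := (norm_nonneg _).trans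
    (hB (0, 0) ⟨⟨le_rfl, zero_le_one⟩, ⟨le_rfl, zero_le_one⟩⟩)
  have main := abs_hierarchy_le hε hε2 hΛ (mul_nonneg hM hU0) (mul_nonneg hM hB0)
    (fun k X => ∫ s in (0 : ℝ)..1, iteratedDeriv k g s * H 0 s X)
    (fun k X => ∫ s in (0 : ℝ)..1, iteratedDeriv k g s * Hx 0 s X)
    (fun k X _ => hdiff k _ _ (h.cont 0) (h.contx 0) (h.hasDerivAt_space 0) X)
    (fun k X hX => ?_) (fun k => hbound k _ (hslice 0 0)) (fun k => ?_) (fun k X hX => ?_) X hX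
  · simpa using main
  · refine (hdiff k _ _ (h.contx 0) (h.contxx 0) (h.hasDerivAt_spacex 0) X).congr_deriv ?_
    have e : ∀ s ∈ uIcc (0 : ℝ) 1, iteratedDeriv k g s * Hxx 0 s X
        = Λ ^ 2 * (iteratedDeriv k g s * H 0 s X) + 1 / ε * (iteratedDeriv k g s * H 1 s X) := by
      intro s hs
      have := h.eqn 0 s (hsT s hs) X hX
      rw [zero_add] at this
      rw [this]
      field_simp
      ring
    rw [intervalIntegral.integral_congr e, intervalIntegral.integral_add,
      intervalIntegral.integral_const_mul, intervalIntegral.integral_const_mul, hparts]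
    · ring
    · exact (continuous_const.mul ((hgc k).mul (hslice 0 X))).intervalIntegrable _ _
    · exact (continuous_const.mul ((hgc k).mul (hslice 1 X))).intervalIntegrable _ _
  · have e : ∀ s ∈ uIcc (0 : ℝ) 1, iteratedDeriv k g s * Hx 0 s 0
        = iteratedDeriv k g s * H 1 s 0 + 1 / (2 * ε) * (iteratedDeriv k g s * H 0 s 0) := by
      intro s hs
      have := h.left 0 s (hsT s hs)
      rw [zero_add] at this
      rw [this]
      ring
    rw [intervalIntegral.integral_congr e, intervalIntegral.integral_add,
      intervalIntegral.integral_const_mul, hparts]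
    · refine (abs_add_le _ _).trans (add_le_add ?_ ?_)
      · rw [abs_neg]
        exact hbound (k + 1) _ (hslice 0 0)
      · rw [abs_mul, abs_of_pos (by positivity), one_div, inv_mul_eq_div]
        gcongr
        exact hbound k _ (hslice 0 0)
    · exact ((hgc k).mul (hslice 1 0)).intervalIntegrable _ _
    · exact (continuous_const.mul ((hgc k).mul (hslice 0 0))).intervalIntegrable _ _
  · refine (hbound k _ (hslice 0 X)).trans ?_
    gcongr
    calc ∫ s in (0 : ℝ)..1, |H 0 s X| ≤ ∫ s in (0 : ℝ)..1, B :=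
          intervalIntegral.integral_mono_on zero_le_one ((hslice 0 X).abs.intervalIntegrable _ _)
            intervalIntegrable_const fun s hs => hB (s, X) ⟨hs, hX⟩
      _ = B := by simp

/-- Self-adjointness: the pairing of the solution with its time reversal is constant. -/
lemma pairing_reflect (h : SymSol T ε Λ H Hx Hxx) (hε : 0 < ε) (hT : 6 ≤ T) {s : ℝ}
    (hs : s ∈ Icc (0 : ℝ) 6) :
    pairing ε (H 0 s) (H 0 (6 - s)) = pairing ε (H 0 3) (H 0 3) := by
  have d : ∀ t ∈ Icc (0 : ℝ) 6, HasDerivAt (fun s => pairing ε (H 0 s) (H 0 (6 - s))) 0 t := by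
    intro t ht
    refine (h.hasDerivAt_pairing 0 0 (a := fun s => s) (b := fun s => 6 - s) continuous_id
      (continuous_const.sub continuous_id) hasDerivAt_id
      (fun s => (hasDerivAt_id s).const_sub 6) t).congr_deriv ?_
    rw [zero_add, h.pairing_succ hε 0 0 ⟨ht.1, ht.2.trans hT⟩, pairing_comm ε (H 0 t),
      h.pairing_succ hε 0 0 ⟨by linarith [ht.2], by linarith [ht.1]⟩,
      dirichletForm_comm ε Λ (H 0 (6 - t))]
    ring
  have hc := constant_of_has_deriv_right_zero
    (fun t ht => (d t ht).continuousAt.continuousWithinAt)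
    (fun t ht => (d t (Ico_subset_Icc_self ht)).hasDerivWithinAt)
  have h1 := (hc s hs).trans (hc 3 ⟨by norm_num, by norm_num⟩).symm
  simpa [show (6 : ℝ) - 3 = 3 by norm_num] using h1

lemma energy_observability (h : SymSol T ε Λ H Hx Hxx) (hε : 0 < ε) (hε2 : ε ≤ 1 / 2)
    (hΛ : 1 / (2 * ε) ≤ Λ) (hT : 6 ≤ T) :
    √(pairing ε (H 0 3) (H 0 3))
      ≤ 32 * √(2 / ε) * Real.exp (400 / ε) * Real.exp Λ * ∫ s in (0 : ℝ)..1, |H 0 s 0| := by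
  set E := pairing ε (H 0 3) (H 0 3) with hE
  have hE0 : 0 ≤ E := pairing_self_nonneg hε.le _
  set U := ∫ s in (0 : ℝ)..1, |H 0 s 0| with hU
  have hU0 : 0 ≤ U := intervalIntegral.integral_nonneg zero_le_one fun _ _ => abs_nonneg _
  set M := √(2 / ε) * √E * Real.exp (16 / ε) with hM
  have hM0 : 0 ≤ M := by positivity
  have hN : 0 < 64 / ε := by positivity
  set ρ := flatBump (64 / ε) with hρ
  have hρc : Continuous ρ := (gevreyTwoOn_flatBump hN univ).1.continuous
  set G : ℝ → ℝ → ℝ := fun s X => ρ s * H 0 (6 - s) X with hG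
  have hGX : ∀ X ∈ Icc (0 : ℝ) 1, |∫ s in (0 : ℝ)..1, G s X * H 0 s X|
      ≤ 8 * (M * U) * Real.exp Λ := by
    intro X hX
    refine h.abs_integral_mul_le hε hε2 hΛ (by linarith) hM0 ?_ (fun s hs => ?_) hX
    · have h1 := (h.gevreyTwoOn_time hε hε2 (a := 3) (by norm_num) hX).comp_const_sub
        (c := 6) (S' := Icc 0 1) fun s hs => ⟨by linarith [hs.2], by linarith [hs.1]⟩
      have h2 := gevreyTwoOn_flatBump hN (Icc 0 1)
      rw [show 4 / (64 / ε) = ε / 16 by field_simp; norm_num] at h2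
      have h3 := h2.mul (by positivity) zero_le_one hM0 h1
      rwa [one_mul, show 2 * (ε / 16) = ε / 8 by ring] at h3
    · simp only [hG]
      rw [hρ, flatBump_eq_zero hs, zero_mul]
  have hcont : Continuous fun p : ℝ × ℝ => G p.1 p.2 * H 0 p.1 p.2 :=
    ((hρc.comp continuous_fst).mul ((h.cont 0).comp
      ((continuous_const.sub continuous_fst).prodMk continuous_snd))).mul (h.cont 0)
  have hcX : ∀ X, Continuous fun s => G s X * H 0 s X := fun X =>
    hcont.comp (continuous_id.prodMk continuous_const)
  have hswap : ∫ s in (0 : ℝ)..1, ∫ X in (0 : ℝ)..1, G s X * H 0 s X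
      = ∫ X in (0 : ℝ)..1, ∫ s in (0 : ℝ)..1, G s X * H 0 s X :=
    MeasureTheory.intervalIntegral_intervalIntegral_swap
      ((hcont.continuousOn.integrableOn_compact (isCompact_uIcc.prod isCompact_uIcc)).mono_set
        (prod_mono uIoc_subset_uIcc uIoc_subset_uIcc))
  have hJ : (∫ s in (0 : ℝ)..1, ρ s) * E
      = (∫ X in (0 : ℝ)..1, ∫ s in (0 : ℝ)..1, G s X * H 0 s X)
        + ε * ((∫ s in (0 : ℝ)..1, G s 0 * H 0 s 0) + ∫ s in (0 : ℝ)..1, G s 1 * H 0 s 1) := by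
    rw [← intervalIntegral.integral_mul_const, ← hswap,
      ← intervalIntegral.integral_add ((hcX 0).intervalIntegrable _ _)
        ((hcX 1).intervalIntegrable _ _), ← intervalIntegral.integral_const_mul,
      ← intervalIntegral.integral_add]
    · refine intervalIntegral.integral_congr fun s hs => ?_
      rw [uIcc_of_le zero_le_one] at hs
      have := h.pairing_reflect hε hT (s := s) ⟨hs.1, by linarith [hs.2]⟩
      rw [hE, ← this, pairing, mul_add, ← intervalIntegral.integral_const_mul]
      simp only [hG]
      congr 1
      · refine intervalIntegral.integral_congr fun X _ => ?_
        ring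
      · ring
    · exact (intervalIntegral.continuous_parametric_intervalIntegral_of_continuous'
        hcont 0 1).intervalIntegrable _ _
    · exact (continuous_const.mul ((hcX 0).add (hcX 1))).intervalIntegrable _ _
  have hR : (∫ s in (0 : ℝ)..1, ρ s) * E ≤ 2 * (8 * (M * U) * Real.exp Λ) := by
    set R := 8 * (M * U) * Real.exp Λ with hRdef
    have hR0 : 0 ≤ R := by positivity
    have h1 : (∫ X in (0 : ℝ)..1, ∫ s in (0 : ℝ)..1, G s X * H 0 s X) ≤ R := by
      calc _ ≤ ∫ X in (0 : ℝ)..1, R := by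
            refine intervalIntegral.integral_mono_on zero_le_one ?_ intervalIntegrable_const
              fun X hX => (le_abs_self _).trans (hGX X hX)
            refine (intervalIntegral.continuous_parametric_intervalIntegral_of_continuous'
              (f := fun X s => G s X * H 0 s X) ?_ 0 1).intervalIntegrable _ _
            exact hcont.comp (continuous_snd.prodMk continuous_fst)
        _ = R := by simp
    have h2 := (le_abs_self _).trans (hGX 0 ⟨le_rfl, zero_le_one⟩)
    have h3 := (le_abs_self _).trans (hGX 1 ⟨zero_le_one, le_rfl⟩)
    rw [hJ]
    nlinarith
  have hρ1 := le_integral_flatBump hN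
  have h5 : Real.exp (-(6 * (64 / ε))) / 2 * E ≤ 2 * (8 * (M * U) * Real.exp Λ) :=
    (mul_le_mul_of_nonneg_right hρ1 hE0).trans hR
  rcases hE0.eq_or_lt with h0 | hpos
  · rw [← h0, Real.sqrt_zero]
    positivity
  have hsq : 0 < √E := Real.sqrt_pos.2 hpos
  refine le_of_mul_le_mul_right ?_ hsq
  rw [Real.mul_self_sqrt hE0]
  have e1 : Real.exp (400 / ε) = Real.exp (6 * (64 / ε)) * Real.exp (16 / ε) := by
    rw [← Real.exp_add]
    congr 1
    ring
  have h6 := mul_le_mul_of_nonneg_left h5 (by positivity : 0 ≤ 2 * Real.exp (6 * (64 / ε)))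
  have e2 : Real.exp (6 * (64 / ε)) * Real.exp (-(6 * (64 / ε))) = 1 := by
    rw [← Real.exp_add, add_neg_cancel, Real.exp_zero]
  calc E = 2 * Real.exp (6 * (64 / ε)) * (Real.exp (-(6 * (64 / ε))) / 2 * E) := by
        linear_combination -E * e2
    _ ≤ _ := h6
    _ = _ := by
        rw [hM, e1]
        ring

end SymSol

/-! ### Reduction of the adjoint system to its symmetrised form -/

/-- The directional derivative `∂_v F`, as a function. -/
def dirDeriv (v : ℝ × ℝ) (F : ℝ × ℝ → ℝ) (p : ℝ × ℝ) : ℝ := fderiv ℝ F p v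

section dirDeriv

variable {F : ℝ × ℝ → ℝ}

lemma contDiff_dirDeriv (hF : ContDiff ℝ (⊤ : ℕ∞) F) (v : ℝ × ℝ) :
    ContDiff ℝ (⊤ : ℕ∞) (dirDeriv v F) :=
  (hF.fderiv_right (m := (⊤ : ℕ∞)) (by exact_mod_cast le_rfl)).clm_apply contDiff_const

lemma contDiff_iterate_dirDeriv (hF : ContDiff ℝ (⊤ : ℕ∞) F) (v : ℝ × ℝ) (k : ℕ) :
    ContDiff ℝ (⊤ : ℕ∞) ((dirDeriv v)^[k] F) := by
  induction k with
  | zero => simpa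
  | succ k ih =>
    rw [Function.iterate_succ_apply']
    exact contDiff_dirDeriv ih v

lemma dirDeriv_comm (hF : ContDiff ℝ (⊤ : ℕ∞) F) (v w : ℝ × ℝ) :
    dirDeriv v (dirDeriv w F) = dirDeriv w (dirDeriv v F) := by
  have hd : Differentiable ℝ (fderiv ℝ F) :=
    (hF.fderiv_right (m := (⊤ : ℕ∞)) (by exact_mod_cast le_rfl)).differentiable (by simp)
  have key : ∀ (v w p : ℝ × ℝ), dirDeriv v (dirDeriv w F) p = fderiv ℝ (fderiv ℝ F) p v w := by
    intro v w p
    have := ((hd p).hasFDerivAt.clm_apply (hasFDerivAt_const w p)).fderiv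
    unfold dirDeriv
    rw [this]
    simp
  funext p
  rw [key, key]
  exact (hF.contDiffAt (x := p)).isSymmSndFDerivAt
    (by simpa using WithTop.coe_le_coe.2 (le_top : (2 : ℕ∞) ≤ ⊤)) v w

lemma hasDerivAt_dirDeriv_fst (hF : ContDiff ℝ (⊤ : ℕ∞) F) (s X : ℝ) :
    HasDerivAt (fun s => F (s, X)) (dirDeriv (1, 0) F (s, X)) s :=
  ((hF.differentiable (by simp)) (s, X)).hasFDerivAt.comp_hasDerivAt s
    ((hasDerivAt_id s).prodMk (hasDerivAt_const s X))

lemma hasDerivAt_dirDeriv_snd (hF : ContDiff ℝ (⊤ : ℕ∞) F) (s X : ℝ) :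
    HasDerivAt (fun X => F (s, X)) (dirDeriv (0, 1) F (s, X)) X :=
  ((hF.differentiable (by simp)) (s, X)).hasFDerivAt.comp_hasDerivAt X
    ((hasDerivAt_const X s).prodMk (hasDerivAt_id X))

end dirDeriv

lemma eq_zero_on_Icc_of_Ioo {f : ℝ → ℝ} {a b : ℝ} (hab : a < b) (hf : Continuous f)
    (h : ∀ s ∈ Ioo a b, f s = 0) : ∀ s ∈ Icc a b, f s = 0 := by
  intro s hs
  rw [← closure_Ioo hab.ne] at hs
  exact EqOn.closure (f := f) (g := fun _ => 0) h hf continuous_const hs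

lemma deriv_sequence_eq_zero {R : ℕ → ℝ → ℝ} {T : ℝ} (hT : 0 < T)
    (hR : ∀ k s, HasDerivAt (R k) (R (k + 1) s) s) (h0 : ∀ s ∈ Ioo 0 T, R 0 s = 0) (k : ℕ) :
    ∀ s ∈ Icc 0 T, R k s = 0 := by
  refine eq_zero_on_Icc_of_Ioo hT
    (continuous_iff_continuousAt.2 fun s => (hR k s).continuousAt) ?_
  induction k with
  | zero => exact h0
  | succ k ih =>
    intro s hs
    refine (hR k s).unique ((hasDerivAt_const s (0 : ℝ)).congr_of_eventuallyEq ?_)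
    filter_upwards [isOpen_Ioo.mem_nhds hs] with t ht using ih t ht

lemma symSol_of_contDiff {T ε Λ : ℝ} (hT : 0 < T) {η : ℝ × ℝ → ℝ}
    (hη : ContDiff ℝ (⊤ : ℕ∞) η)
    (heq : ∀ s ∈ Ioo 0 T, ∀ X ∈ Ioo (0 : ℝ) 1, dirDeriv (1, 0) η (s, X)
      = ε * (dirDeriv (0, 1) (dirDeriv (0, 1) η) (s, X) - Λ ^ 2 * η (s, X)))
    (hleft : ∀ s ∈ Ioo 0 T, dirDeriv (1, 0) η (s, 0)
      = dirDeriv (0, 1) η (s, 0) - η (s, 0) / (2 * ε))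
    (hright : ∀ s ∈ Ioo 0 T, dirDeriv (1, 0) η (s, 1)
      = -dirDeriv (0, 1) η (s, 1) - η (s, 1) / (2 * ε)) :
    SymSol T ε Λ (fun k s X => (dirDeriv (1, 0))^[k] η (s, X))
      (fun k s X => dirDeriv (0, 1) ((dirDeriv (1, 0))^[k] η) (s, X))
      (fun k s X => dirDeriv (0, 1) (dirDeriv (0, 1) ((dirDeriv (1, 0))^[k] η)) (s, X)) := by
  set h : ℕ → ℝ × ℝ → ℝ := fun k => (dirDeriv (1, 0))^[k] η with hh
  have hsucc : ∀ k, h (k + 1) = dirDeriv (1, 0) (h k) := fun k =>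
    Function.iterate_succ_apply' _ _ _
  have c0 : ∀ k, ContDiff ℝ (⊤ : ℕ∞) (h k) := contDiff_iterate_dirDeriv hη _
  have c1 : ∀ k, ContDiff ℝ (⊤ : ℕ∞) (dirDeriv (0, 1) (h k)) := fun k => contDiff_dirDeriv (c0 k) _
  have c2 : ∀ k, ContDiff ℝ (⊤ : ℕ∞) (dirDeriv (0, 1) (dirDeriv (0, 1) (h k))) := fun k =>
    contDiff_dirDeriv (c1 k) _
  have d0 : ∀ k s X, HasDerivAt (fun s => h k (s, X)) (h (k + 1) (s, X)) s := fun k s X => by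
    rw [hsucc]
    exact hasDerivAt_dirDeriv_fst (c0 k) s X
  have d1 : ∀ k s X, HasDerivAt (fun s => dirDeriv (0, 1) (h k) (s, X))
      (dirDeriv (0, 1) (h (k + 1)) (s, X)) s := fun k s X => by
    rw [hsucc, dirDeriv_comm (c0 k) (0, 1) (1, 0)]
    exact hasDerivAt_dirDeriv_fst (c1 k) s X
  have d2 : ∀ k s X, HasDerivAt (fun s => dirDeriv (0, 1) (dirDeriv (0, 1) (h k)) (s, X))
      (dirDeriv (0, 1) (dirDeriv (0, 1) (h (k + 1))) (s, X)) s := fun k s X => by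
    rw [hsucc, dirDeriv_comm (c0 k) (0, 1) (1, 0), dirDeriv_comm (c1 k) (0, 1) (1, 0)]
    exact hasDerivAt_dirDeriv_fst (c2 k) s X
  have h1 : ∀ p, h 1 p = dirDeriv (1, 0) η p := fun p => congrFun (hsucc 0) p
  refine ⟨fun k => (c0 k).continuous, fun k => (c1 k).continuous, fun k => (c2 k).continuous,
    d0, fun k s X => hasDerivAt_dirDeriv_snd (c0 k) s X,
    fun k s X => hasDerivAt_dirDeriv_snd (c1 k) s X, fun k s hs X hX => ?_,
    fun k s hs => ?_, fun k s hs => ?_⟩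
  · have key := eq_zero_on_Icc_of_Ioo zero_lt_one
      (f := fun X => h (k + 1) (s, X)
        - ε * (dirDeriv (0, 1) (dirDeriv (0, 1) (h k)) (s, X) - Λ ^ 2 * h k (s, X)))
      (((c0 (k + 1)).continuous.comp (by fun_prop)).sub (continuous_const.mul
        (((c2 k).continuous.comp (by fun_prop)).sub
          (continuous_const.mul ((c0 k).continuous.comp (by fun_prop))))))
      (fun Y hY => deriv_sequence_eq_zero (R := fun k s => h (k + 1) (s, Y)
          - ε * (dirDeriv (0, 1) (dirDeriv (0, 1) (h k)) (s, Y) - Λ ^ 2 * h k (s, Y))) hT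
        (fun k s => (d0 (k + 1) s Y).sub (((d2 k s Y).sub ((d0 k s Y).const_mul _)).const_mul _))
        (fun s hs => by
          simp only [zero_add, h1]
          exact sub_eq_zero.2 (heq s hs Y hY)) k s hs) X hX
    exact sub_eq_zero.1 key
  · have key := deriv_sequence_eq_zero (R := fun k s => h (k + 1) (s, 0)
        - (dirDeriv (0, 1) (h k) (s, 0) - h k (s, 0) / (2 * ε))) hT
      (fun k s => (d0 (k + 1) s 0).sub ((d1 k s 0).sub ((d0 k s 0).div_const _)))
      (fun s hs => by
        simp only [zero_add, h1]
        exact sub_eq_zero.2 (hleft s hs)) k s hs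
    exact sub_eq_zero.1 key
  · have key := deriv_sequence_eq_zero (R := fun k s => h (k + 1) (s, 1)
        - (-dirDeriv (0, 1) (h k) (s, 1) - h k (s, 1) / (2 * ε))) hT
      (fun k s => (d0 (k + 1) s 1).sub ((d1 k s 1).neg.sub ((d0 k s 1).div_const _)))
      (fun s hs => by
        simp only [zero_add, h1]
        exact sub_eq_zero.2 (hright s hs)) k s hs
    exact sub_eq_zero.1 key

/-- Reversing time, reflecting space and removing the drift by the weight `e^{-X/(2ε)}` turns
the adjoint system into its symmetrised form. -/
lemma IsAdjSol1D.exists_symSol {T ε a : ℝ} {φ : ℝ → ℝ → ℝ} (hT : 0 < T) (hε : 0 < ε)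
    (ha : 0 ≤ a) (h : IsAdjSol1D T ε a φ) :
    ∃ H Hx Hxx, SymSol T ε √(a / ε + 1 / (4 * ε ^ 2)) H Hx Hxx ∧
      ∀ s X, H 0 s X = Real.exp (-X / (2 * ε)) * φ (T - s) (-X) := by
  obtain ⟨hφ, heq, h0, h1⟩ := h
  set Φ : ℝ × ℝ → ℝ := fun p => φ p.1 p.2 with hΦ
  set η : ℝ × ℝ → ℝ := fun p => Real.exp (-p.2 / (2 * ε)) * Φ (T - p.1, -p.2) with hη
  have cΦx := contDiff_dirDeriv hφ (0, 1)
  have cη : ContDiff ℝ (⊤ : ℕ∞) η :=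
    (contDiff_snd.neg.div_const _).exp.mul
      (hφ.comp ((contDiff_const.sub contDiff_fst).prodMk contDiff_snd.neg))
  have et : ∀ t x, deriv (fun s => φ s x) t = dirDeriv (1, 0) Φ (t, x) := fun t x =>
    (hasDerivAt_dirDeriv_fst hφ t x).deriv
  have ex : ∀ t x, deriv (fun y => φ t y) x = dirDeriv (0, 1) Φ (t, x) := fun t x =>
    (hasDerivAt_dirDeriv_snd hφ t x).deriv
  have exx : ∀ t x, deriv (deriv (fun y => φ t y)) x
      = dirDeriv (0, 1) (dirDeriv (0, 1) Φ) (t, x) := fun t x => by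
    rw [show deriv (fun y => φ t y) = fun x => dirDeriv (0, 1) Φ (t, x) from funext (ex t)]
    exact (hasDerivAt_dirDeriv_snd cΦx t x).deriv
  have dexp : ∀ X : ℝ, HasDerivAt (fun X => Real.exp (-X / (2 * ε)))
      (Real.exp (-X / (2 * ε)) * (-1 / (2 * ε))) X := fun X =>
    ((hasDerivAt_id X).neg.div_const _).exp
  have dΦ : ∀ {F : ℝ × ℝ → ℝ}, ContDiff ℝ (⊤ : ℕ∞) F → ∀ s X,
      HasDerivAt (fun X => F (T - s, -X)) (-dirDeriv (0, 1) F (T - s, -X)) X := fun hF s X => by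
    have := (hasDerivAt_dirDeriv_snd hF (T - s) (-X)).comp X (hasDerivAt_neg X)
    rwa [mul_neg_one] at this
  have ηt : ∀ s X, dirDeriv (1, 0) η (s, X)
      = -(Real.exp (-X / (2 * ε)) * dirDeriv (1, 0) Φ (T - s, -X)) := fun s X => by
    have := ((hasDerivAt_dirDeriv_fst hφ (T - s) (-X)).comp s
      ((hasDerivAt_id s).const_sub T)).const_mul (Real.exp (-X / (2 * ε)))
    rw [(hasDerivAt_dirDeriv_fst cη s X).unique this]
    ring
  have ηx : ∀ s X, dirDeriv (0, 1) η (s, X) = Real.exp (-X / (2 * ε))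
      * (-Φ (T - s, -X) / (2 * ε) - dirDeriv (0, 1) Φ (T - s, -X)) := fun s X => by
    rw [(hasDerivAt_dirDeriv_snd cη s X).unique ((dexp X).mul (dΦ hφ s X))]
    ring
  have ηxx : ∀ s X, dirDeriv (0, 1) (dirDeriv (0, 1) η) (s, X) = Real.exp (-X / (2 * ε))
      * (Φ (T - s, -X) / (4 * ε ^ 2) + dirDeriv (0, 1) Φ (T - s, -X) / ε
        + dirDeriv (0, 1) (dirDeriv (0, 1) Φ) (T - s, -X)) := fun s X => by
    have := (dexp X).mul (((dΦ hφ s X).neg.div_const (2 * ε)).sub (dΦ cΦx s X))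
    rw [(hasDerivAt_dirDeriv_snd (contDiff_dirDeriv cη _) s X).unique
      (this.congr_of_eventuallyEq (Filter.Eventually.of_forall fun X => ηx s X))]
    simp only [Pi.sub_apply, Pi.neg_apply]
    field_simp
    ring
  refine ⟨_, _, _, symSol_of_contDiff hT cη (fun s hs X hX => ?_) (fun s hs => ?_)
    (fun s hs => ?_), fun s X => rfl⟩
  · have := heq (T - s) ⟨by linarith [hs.2], by linarith [hs.1]⟩ (-X)
      ⟨by linarith [hX.2], by linarith [hX.1]⟩
    rw [et, ex, exx] at this
    rw [ηt, ηxx, Real.sq_sqrt (by positivity)]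
    simp only [hη]
    have e : dirDeriv (1, 0) Φ (T - s, -X) = a * Φ (T - s, -X) - dirDeriv (0, 1) Φ (T - s, -X)
        - ε * dirDeriv (0, 1) (dirDeriv (0, 1) Φ) (T - s, -X) := by
      simp only [hΦ] at this ⊢
      linarith
    rw [e]
    field_simp
    ring
  · have := h0 (T - s) ⟨by linarith [hs.2], by linarith [hs.1]⟩
    rw [et, ex] at this
    rw [ηt, ηx]
    simp only [hη, neg_zero]
    have e : dirDeriv (1, 0) Φ (T - s, 0) = dirDeriv (0, 1) Φ (T - s, 0) + Φ (T - s, 0) / ε := by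
      simp only [hΦ] at this ⊢
      field_simp
      linarith
    rw [e]
    field_simp
    ring
  · have := h1 (T - s) ⟨by linarith [hs.2], by linarith [hs.1]⟩
    rw [et, ex] at this
    rw [ηt, ηx, eq_neg_of_add_eq_zero_left this]
    simp only [hη]
    field_simp
    ring

lemma X1normSq_le_pairing {ε : ℝ} (hε : 0 < ε) {ψ f : ℝ → ℝ} (hψ : Continuous ψ)
    (hf : ∀ X, f X = Real.exp (-X / (2 * ε)) * ψ (-X)) :
    X1normSq ε ψ ≤ Real.exp (1 / ε) * pairing ε f f := by
  have hfc : Continuous f := by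
    rw [show f = fun X => Real.exp (-X / (2 * ε)) * ψ (-X) from funext hf]
    fun_prop
  have hle : ∀ X ∈ Icc (0 : ℝ) 1, ψ (-X) ^ 2 ≤ Real.exp (1 / ε) * (f X * f X) := by
    intro X hX
    have e : Real.exp (1 / ε) * (f X * f X) = Real.exp ((1 - X) / ε) * ψ (-X) ^ 2 := by
      rw [hf, show (1 - X) / ε = 1 / ε + -X / (2 * ε) + -X / (2 * ε) by field_simp; ring,
        Real.exp_add, Real.exp_add]
      ring
    rw [e]
    exact le_mul_of_one_le_left (sq_nonneg _)
      (Real.one_le_exp (div_nonneg (by linarith [hX.2]) hε.le))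
  have hint : ∫ x in (-1 : ℝ)..0, ψ x ^ 2 ≤ Real.exp (1 / ε) * ∫ X in (0 : ℝ)..1, f X * f X := by
    rw [← intervalIntegral.integral_const_mul]
    have e : ∫ x in (-1 : ℝ)..0, ψ x ^ 2 = ∫ X in (0 : ℝ)..1, ψ (-X) ^ 2 := by
      rw [intervalIntegral.integral_comp_neg (fun x => ψ x ^ 2), neg_zero]
    rw [e]
    exact intervalIntegral.integral_mono_on zero_le_one
      (Continuous.intervalIntegrable (by fun_prop) _ _)
      (Continuous.intervalIntegrable (by fun_prop) _ _) hle
  have h0 := hle 0 ⟨le_rfl, zero_le_one⟩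
  have h1 := hle 1 ⟨zero_le_one, le_rfl⟩
  rw [neg_zero] at h0
  unfold X1normSq pairing
  nlinarith [mul_le_mul_of_nonneg_left (add_le_add h0 h1) hε.le]

lemma integral_abs_le_sqrt_integral_sq {f : ℝ → ℝ} (hf : Continuous f) :
    ∫ s in (0 : ℝ)..1, |f s| ≤ √(∫ s in (0 : ℝ)..1, f s ^ 2) := by
  refine Real.le_sqrt_of_sq_le ?_
  set m := ∫ s in (0 : ℝ)..1, |f s| with hm
  have h0 : 0 ≤ ∫ s in (0 : ℝ)..1, (|f s| - m) ^ 2 :=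
    intervalIntegral.integral_nonneg zero_le_one fun _ _ => sq_nonneg _
  have e : ∫ s in (0 : ℝ)..1, (|f s| - m) ^ 2
      = (∫ s in (0 : ℝ)..1, f s ^ 2) - 2 * m * m + m ^ 2 := by
    have : ∀ s, (|f s| - m) ^ 2 = f s ^ 2 - 2 * m * |f s| + m ^ 2 := fun s => by
      rw [sub_sq, sq_abs]
      ring
    simp only [this]
    rw [intervalIntegral.integral_add (Continuous.intervalIntegrable (by fun_prop) _ _)
      (by simp), intervalIntegral.integral_sub (Continuous.intervalIntegrable (by fun_prop) _ _)
      (Continuous.intervalIntegrable (by fun_prop) _ _), intervalIntegral.integral_const_mul, ← hm]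
    simp
  rw [e] at h0
  linarith

lemma SymSol.energy_terminal_le {T ε Λ : ℝ} {H Hx Hxx : ℕ → ℝ → ℝ → ℝ}
    (h : SymSol T ε Λ H Hx Hxx) (hε : 0 < ε) (hε2 : ε ≤ 1 / 2) (hΛ : 1 / (2 * ε) ≤ Λ)
    (hT : 6 ≤ T) :
    √(pairing ε (H 0 T) (H 0 T)) ≤ Real.exp (404 / ε - Λ * ((T - 3) / 7 - 1))
      * ∫ s in (0 : ℝ)..1, |H 0 s 0| := by
  have h1 := Real.sqrt_le_sqrt
    (h.energy_decay hε hε2 hΛ (a := 3) (by norm_num) (by linarith))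
  rw [Real.sqrt_mul (Real.exp_pos _).le] at h1
  have e1 : √(Real.exp (-(2 * Λ / 7) * (T - 3))) = Real.exp (-(Λ / 7) * (T - 3)) := by
    rw [show Real.exp (-(2 * Λ / 7) * (T - 3)) = Real.exp (-(Λ / 7) * (T - 3)) ^ 2 by
      rw [← Real.exp_nat_mul]
      congr 1
      push_cast
      ring]
    exact Real.sqrt_sq (Real.exp_pos _).le
  have h2 := h.energy_observability hε hε2 hΛ hT
  have hU0 : 0 ≤ ∫ s in (0 : ℝ)..1, |H 0 s 0| :=
    intervalIntegral.integral_nonneg zero_le_one fun _ _ => abs_nonneg _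
  have h3 : 32 * √(2 / ε) ≤ Real.exp (4 / ε) := by
    have hy : 2 ≤ 1 / ε := by rw [le_div_iff₀ hε]; linarith
    have i1 : √(2 / ε) ≤ 1 / ε := by
      refine Real.sqrt_le_iff.2 ⟨by positivity, ?_⟩
      rw [show 2 / ε = 2 * (1 / ε) by ring]
      nlinarith
    have i2 : (2 : ℝ) ≤ Real.exp 1 := by linarith [Real.add_one_le_exp (1 : ℝ)]
    have i3 : (64 : ℝ) ≤ Real.exp 6 := by
      have : Real.exp 6 = Real.exp 1 ^ 6 := by rw [← Real.exp_nat_mul]; norm_num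
      rw [this]
      calc (64 : ℝ) = 2 ^ 6 := by norm_num
        _ ≤ _ := by gcongr
    have i4 : 1 / ε ≤ Real.exp (1 / ε - 1) := by linarith [Real.add_one_le_exp (1 / ε - 1)]
    calc 32 * √(2 / ε) ≤ Real.exp 6 * Real.exp (1 / ε - 1) := by
          gcongr
          · linarith
          · exact i1.trans i4
      _ = Real.exp (6 + (1 / ε - 1)) := (Real.exp_add _ _).symm
      _ ≤ Real.exp (4 / ε) := by
          refine Real.exp_le_exp.2 ?_
          rw [show 4 / ε = 4 * (1 / ε) by ring]
          linarith
  calc _ ≤ _ := h1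
    _ ≤ Real.exp (-(Λ / 7) * (T - 3)) * (Real.exp (4 / ε) * Real.exp (400 / ε) * Real.exp Λ
          * ∫ s in (0 : ℝ)..1, |H 0 s 0|) := by
        rw [e1]
        refine mul_le_mul_of_nonneg_left (h2.trans ?_) (Real.exp_pos _).le
        gcongr
    _ = _ := by
        rw [← mul_assoc, ← Real.exp_add, ← Real.exp_add, ← Real.exp_add]
        congr 2
        ring

/-- Observability form of Proposition 1.1: for `T` large enough there are `C, k > 0`
independent of `a ≥ 0` and `ε ∈ (0, ε0)` with
`‖φ(0,·)‖_{X¹} ≤ C e^{−k/ε} (∫_0^T |φ(t,0)|² dt)^{1/2}`. -/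
theorem observability_1d_with_parameter :
    ∃ T0 > (0:ℝ), ∀ T ≥ T0, ∃ ε0 > (0:ℝ), ∃ C > (0:ℝ), ∃ k > (0:ℝ),
      ∀ a ≥ (0:ℝ), ∀ ε ∈ Set.Ioo (0:ℝ) ε0, ∀ φ : ℝ → ℝ → ℝ,
        IsAdjSol1D T ε a φ →
        Real.sqrt (X1normSq ε (φ 0)) ≤
          C * Real.exp (-k / ε) * Real.sqrt (∫ t in (0:ℝ)..T, φ t 0 ^ 2) := by
  refine ⟨6000, by norm_num, fun T hT => ⟨1 / 2, by norm_num, 1, one_pos, 1, one_pos, ?_⟩⟩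
  rintro a ha ε ⟨hε, hε2⟩ φ hφ
  have hT0 : 0 < T := by linarith
  have hφc : Continuous fun p : ℝ × ℝ => φ p.1 p.2 := hφ.1.continuous
  obtain ⟨H, Hx, Hxx, h, hH⟩ := hφ.exists_symSol hT0 hε ha
  set Λ := √(a / ε + 1 / (4 * ε ^ 2)) with hΛdef
  have hΛ : 1 / (2 * ε) ≤ Λ := by
    refine Real.le_sqrt_of_sq_le ?_
    have e : (1 / (2 * ε)) ^ 2 = 1 / (4 * ε ^ 2) := by
      field_simp
      norm_num
    rw [e]
    exact le_add_of_nonneg_left (div_nonneg ha hε.le)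
  have h1 : X1normSq ε (φ 0) ≤ Real.exp (1 / ε) * pairing ε (H 0 T) (H 0 T) :=
    X1normSq_le_pairing hε (hφc.comp (continuous_const.prodMk continuous_id)) fun X => by
      rw [hH, sub_self]
  have h2 := h.energy_terminal_le hε hε2.le hΛ (by linarith)
  have h3 : ∫ s in (0 : ℝ)..1, |H 0 s 0| ≤ √(∫ t in (0 : ℝ)..T, φ t 0 ^ 2) := by
    refine (integral_abs_le_sqrt_integral_sq (f := fun s => H 0 s 0)
      ((h.cont 0).comp (continuous_id.prodMk continuous_const))).trans (Real.sqrt_le_sqrt ?_)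
    have hc : Continuous fun t => φ t 0 := hφc.comp (continuous_id.prodMk continuous_const)
    have e : ∫ s in (0 : ℝ)..1, H 0 s 0 ^ 2 = ∫ t in (T - 1)..T, φ t 0 ^ 2 := by
      have := intervalIntegral.integral_comp_sub_left (a := 0) (b := 1) (fun t => φ t 0 ^ 2) T
      rw [sub_zero] at this
      rw [← this]
      simp [hH]
    rw [e]
    exact intervalIntegral.integral_mono_interval (by linarith) (by linarith) le_rfl
      (Filter.Eventually.of_forall fun _ => sq_nonneg _)
      ((hc.pow 2).intervalIntegrable _ _)
  calc √(X1normSq ε (φ 0)) ≤ √(Real.exp (1 / ε) * pairing ε (H 0 T) (H 0 T)) :=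
        Real.sqrt_le_sqrt h1
    _ ≤ √(Real.exp (1 / ε) ^ 2 * pairing ε (H 0 T) (H 0 T)) := by
        refine Real.sqrt_le_sqrt (mul_le_mul_of_nonneg_right ?_ (pairing_self_nonneg hε.le _))
        exact le_self_pow₀ (Real.one_le_exp (by positivity)) two_ne_zero
    _ = Real.exp (1 / ε) * √(pairing ε (H 0 T) (H 0 T)) := by
        rw [Real.sqrt_mul (by positivity), Real.sqrt_sq (Real.exp_pos _).le]
    _ ≤ Real.exp (1 / ε) * (Real.exp (404 / ε - Λ * ((T - 3) / 7 - 1))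
          * √(∫ t in (0 : ℝ)..T, φ t 0 ^ 2)) := by
        gcongr
        exact h2.trans (mul_le_mul_of_nonneg_left h3 (Real.exp_pos _).le)
    _ ≤ _ := by
        rw [← mul_assoc, ← Real.exp_add, one_mul]
        refine mul_le_mul_of_nonneg_right (Real.exp_le_exp.2 ?_) (Real.sqrt_nonneg _)
        have e1 : 1 / ε = 2 * (1 / (2 * ε)) := by
          field_simp
        have e2 : 404 / ε = 808 * (1 / (2 * ε)) := by
          field_simp
          norm_num
        have e3 : -1 / ε = -2 * (1 / (2 * ε)) := by
          field_simp
        rw [e1, e2, e3]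
        have hp : 0 < 1 / (2 * ε) := by positivity
        have : 812 * Λ ≤ Λ * ((T - 3) / 7 - 1) := by
          rw [mul_comm Λ]
          exact mul_le_mul_of_nonneg_right (by linarith) (hp.le.trans hΛ)
        linarith
end
end
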